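/- arXiv:1304.0103 — 4 statements merged into one kernel-verified Lean document; each statement's English description precedes it below -/
import Mathlib

section
/- Let p ∈ (0,1) and suppose there exist positive integers λ_1, ..., λ_N (repetitions allowed) with gcd(λ_1, ..., λ_N) = 1 such that p^{λ_1} + p^{λ_2} + ... + p^{λ_N} = 1. Then {a ∈ Z[p] : a > 0} = Z^+[p]; that is, every positive element of Z[p] can be written as P(p) for some nonzero polynomial P with nonnegative integer coefficients. -/
noncomputable section

/-- The subring `ℤ[p]` of `ℝ` generated by `ℤ` and `p`. -/
def Zring (p : ℝ) : Subring ℝ := Subring.closure {p}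

/-- `Z^+[s]`: the smallest subset of `ℝ` containing the set `s` and all positive
integers which is closed under addition and multiplication; equivalently, the set of
all values `P` applied to elements of `s` for `P` a nonzero polynomial with
nonnegative integer coefficients. -/
def Zplus (s : Set ℝ) : Set ℝ :=
  ⋂₀ {T : Set ℝ | s ⊆ T ∧ (∀ n : ℕ, 0 < n → (n : ℝ) ∈ T) ∧
      (∀ x ∈ T, ∀ y ∈ T, x + y ∈ T) ∧ (∀ x ∈ T, ∀ y ∈ T, x * y ∈ T)}

/-- The solution of the renewal equation `b n = a n + ∑ i, b (n - lam i)`, where the terms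
with `n < lam i` are dropped. -/
def renewalSeq {ι : Type*} [Fintype ι] (lam : ι → ℕ) (a : ℕ → ℤ) (n : ℕ) : ℤ :=
  a n + ∑ i, if _h : 0 < lam i ∧ lam i ≤ n then renewalSeq lam a (n - lam i) else 0
termination_by n
decreasing_by omega

section Renewal

variable {ι : Type*} [Fintype ι] {lam : ι → ℕ} {p : ℝ}

theorem sum_range_eq_sum_renewalSeq (hpos : ∀ i, 0 < lam i) (hsum : ∑ i, p ^ lam i = 1)
    (a : ℕ → ℤ) (n : ℕ) :
    ∑ k ∈ Finset.range n, (a k : ℝ) * p ^ k =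
      ∑ i, ∑ k ∈ Finset.Ico (n - lam i) n, (renewalSeq lam a k : ℝ) * p ^ (k + lam i) := by
  induction n with
  | zero => simp
  | succ n ih =>
    have key : ∀ i, ∑ k ∈ Finset.Ico (n + 1 - lam i) (n + 1),
        (renewalSeq lam a k : ℝ) * p ^ (k + lam i) =
        (∑ k ∈ Finset.Ico (n - lam i) n, (renewalSeq lam a k : ℝ) * p ^ (k + lam i))
          + (renewalSeq lam a n : ℝ) * p ^ n * p ^ lam i
          - (if 0 < lam i ∧ lam i ≤ n then (renewalSeq lam a (n - lam i) : ℝ) else 0) * p ^ n := by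
      intro i
      have hi := hpos i
      rw [Finset.sum_Ico_succ_top (by omega)]
      split_ifs with h
      · rw [Finset.sum_eq_sum_Ico_succ_bot (a := n - lam i) (by omega),
          show n - lam i + 1 = n + 1 - lam i by omega, show n - lam i + lam i = n by omega]
        ring
      · rw [show n + 1 - lam i = n - lam i by omega]
        ring
    have hb : (renewalSeq lam a n : ℝ) = a n +
        ∑ i, if 0 < lam i ∧ lam i ≤ n then (renewalSeq lam a (n - lam i) : ℝ) else 0 := by
      conv_lhs => rw [renewalSeq]
      push_cast
      simp only [dite_eq_ite, Int.cast_ite, Int.cast_zero]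
    rw [Finset.sum_range_succ, ih, Finset.sum_congr rfl fun i _ => key i,
      Finset.sum_sub_distrib, Finset.sum_add_distrib, ← Finset.mul_sum, ← Finset.sum_mul, hsum,
      hb]
    ring

theorem renewalSeq_mul_pow (hpos : ∀ i, 0 < lam i) {a : ℕ → ℤ} {n : ℕ} (ha : a n = 0)
    (hn : ∀ i, lam i ≤ n) :
    (renewalSeq lam a n : ℝ) * p ^ n =
      ∑ i, p ^ lam i * ((renewalSeq lam a (n - lam i) : ℝ) * p ^ (n - lam i)) := by
  rw [renewalSeq, ha]
  push_cast
  rw [zero_add, Finset.sum_mul]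
  refine Finset.sum_congr rfl fun i _ => ?_
  rw [dif_pos ⟨hpos i, hn i⟩]
  conv_lhs => rw [← Nat.sub_add_cancel (hn i), pow_add]
  rw [Nat.sub_add_cancel (hn i)]
  ring

variable {β : ℕ → ℝ} {L n₀ : ℕ}

/-- A lower bound on a window of length `L` propagates through a convex recurrence of
depth at most `L`. -/
theorem le_of_le_on_window (hp : 0 ≤ p) (hpos : ∀ i, 0 < lam i) (hsum : ∑ i, p ^ lam i = 1)
    (hL : ∀ i, lam i ≤ L)
    (hrec : ∀ n ≥ n₀, β n = ∑ i, p ^ lam i * β (n - lam i)) {n : ℕ} (hn : n₀ ≤ n) {m : ℝ}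
    (hm : ∀ j, n ≤ j → j < n + L → m ≤ β j) (j : ℕ) (hj : n ≤ j) : m ≤ β j := by
  induction j using Nat.strong_induction_on with
  | _ j ih =>
    rcases lt_or_ge j (n + L) with h | h
    · exact hm j hj h
    · rw [hrec j (by omega)]
      calc m = ∑ i, p ^ lam i * m := by rw [← Finset.sum_mul, hsum, one_mul]
        _ ≤ _ := by
          refine Finset.sum_le_sum fun i _ => ?_
          have h1 := hpos i
          have h2 := hL i
          exact mul_le_mul_of_nonneg_left (ih _ (by omega) (by omega)) (pow_nonneg hp _)

theorem pow_mul_sub_le_of_mem_closure (hp : 0 ≤ p) (hsum : ∑ i, p ^ lam i = 1)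
    (hL : ∀ i, lam i ≤ L)
    (hrec : ∀ n ≥ n₀, β n = ∑ i, p ^ lam i * β (n - lam i)) {n : ℕ} (hn : n₀ ≤ n) {m : ℝ}
    (hm : ∀ j ≥ n, m ≤ β j) {t : ℕ} (ht : t ∈ AddSubmonoid.closure (Set.range lam)) :
    ∀ k ≥ n + L, p ^ t * (β k - m) ≤ β (k + t) - m := by
  induction ht using AddSubmonoid.closure_induction with
  | mem t ht =>
    obtain ⟨i, rfl⟩ := ht
    intro k hk
    have h : β (k + lam i) - m = ∑ j, p ^ lam j * (β (k + lam i - lam j) - m) := by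
      simp_rw [mul_sub]
      rw [Finset.sum_sub_distrib, ← Finset.sum_mul, hsum, one_mul, hrec _ (by omega)]
    rw [h]
    refine le_trans (by simp) (Finset.single_le_sum
      (f := fun j => p ^ lam j * (β (k + lam i - lam j) - m)) (fun j _ => ?_) (Finset.mem_univ i))
    have h2 := hL j
    exact mul_nonneg (pow_nonneg hp _) (sub_nonneg.2 (hm _ (by omega)))
  | zero => intro k _; simp
  | add s t _ _ hs ht =>
    intro k hk
    rw [← add_assoc]
    refine le_trans ?_ (ht (k + s) (by omega))
    rw [pow_add, mul_comm (p ^ s), mul_assoc]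
    exact mul_le_mul_of_nonneg_left (hs k hk) (pow_nonneg hp _)

theorem exists_div_le_on_window (hp : 0 < p) (hpos : ∀ i, 0 < lam i)
    (hsum : ∑ i, p ^ lam i = 1) (hL : ∀ i, lam i ≤ L) (hL0 : 0 < L) {s : ℝ} (hs : 0 < s) {n : ℕ}
    (hn : L ≤ n) (hw : s = ∑ i, p ^ lam i * ∑ k ∈ Finset.Ico (n - lam i) n, β k) :
    ∃ k, n - L ≤ k ∧ k < n ∧ s / L ≤ β k := by
  by_contra! hcon
  have hL' : (0 : ℝ) < L := by exact_mod_cast hL0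
  have hι : (Finset.univ : Finset ι).Nonempty := by
    by_contra h
    rw [Finset.not_nonempty_iff_eq_empty] at h
    rw [h] at hsum
    simp at hsum
  have : s < s := by
    calc s = ∑ i, p ^ lam i * ∑ k ∈ Finset.Ico (n - lam i) n, β k := hw
      _ < ∑ i, p ^ lam i * s := by
        refine Finset.sum_lt_sum_of_nonempty hι fun i _ => ?_
        have h1 := hpos i
        have h2 := hL i
        refine mul_lt_mul_of_pos_left ?_ (pow_pos hp _)
        calc ∑ k ∈ Finset.Ico (n - lam i) n, β k
            < ∑ k ∈ Finset.Ico (n - lam i) n, s / L := by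
              refine Finset.sum_lt_sum_of_nonempty ?_ fun k hk => ?_
              · rw [Finset.nonempty_Ico]; omega
              · rw [Finset.mem_Ico] at hk
                exact hcon k (by omega) hk.2
          _ = lam i * (s / L) := by
              rw [Finset.sum_const, Nat.card_Ico, nsmul_eq_mul,
                show n - (n - lam i) = lam i by omega]
          _ ≤ L * (s / L) := by
              refine mul_le_mul_of_nonneg_right ?_ (by positivity)
              exact_mod_cast h2
          _ = s := by field_simp
      _ = s := by rw [← Finset.sum_mul, hsum, one_mul]
  exact lt_irrefl _ this

/-- A solution of an aperiodic convex recurrence with positive conserved quantity is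
eventually nonnegative. -/
theorem eventually_nonneg_of_recurrence (hp0 : 0 < p) (hp1 : p < 1) (hpos : ∀ i, 0 < lam i)
    (hgcd : Finset.univ.gcd lam = 1) (hsum : ∑ i, p ^ lam i = 1)
    (hL : ∀ i, lam i ≤ L) (hL0 : 0 < L)
    (hrec : ∀ n ≥ n₀, β n = ∑ i, p ^ lam i * β (n - lam i)) {s : ℝ} (hs : 0 < s)
    (hw : ∀ n ≥ n₀, s = ∑ i, p ^ lam i * ∑ k ∈ Finset.Ico (n - lam i) n, β k) :
    ∃ n, ∀ j ≥ n, 0 ≤ β j := by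
  obtain ⟨F, hF⟩ : ∃ F, ∀ t ≥ F, t ∈ AddSubmonoid.closure (Set.range lam) := by
    obtain ⟨F, hF⟩ := Nat.exists_mem_closure_of_ge (Set.range lam)
    refine ⟨F, fun t ht => hF t ht ?_⟩
    have h : Nat.setGcd (Set.range lam) ∣ Finset.univ.gcd lam :=
      Finset.dvd_gcd fun i _ => Nat.setGcd_dvd_of_mem ⟨i, rfl⟩
    rw [hgcd] at h
    exact h.trans (one_dvd t)
  have hc : 0 < s / L := by positivity
  set c := s / L
  have hδ : 0 < p ^ (F + 2 * L) * c := by positivity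
  have step : ∀ n ≥ n₀, ∀ m ≤ 0, (∀ j ≥ n, m ≤ β j) →
      ∃ n' ≥ n₀, ∀ j ≥ n', m + p ^ (F + 2 * L) * c ≤ β j := by
    intro n hn m hm0 hm
    obtain ⟨k, hk1, hk2, hk⟩ := exists_div_le_on_window hp0 hpos hsum hL hL0 hs
      (n := n + 2 * L) (by omega) (hw _ (by omega))
    refine ⟨n + 2 * L + F, by omega, le_of_le_on_window hp0.le hpos hsum hL hrec (by omega) ?_⟩
    intro j hj1 hj2
    have h := pow_mul_sub_le_of_mem_closure hp0.le hsum hL hrec hn hm (hF (j - k) (by omega)) k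
      (by omega)
    rw [show k + (j - k) = j by omega] at h
    have h2 : p ^ (F + 2 * L) * c ≤ p ^ (j - k) * (β k - m) :=
      mul_le_mul (pow_le_pow_of_le_one hp0.le hp1.le (by omega)) (by linarith) hc.le
        (pow_nonneg hp0.le _)
    linarith
  obtain ⟨m, hm⟩ : ∃ m, ∀ j ≥ n₀, m ≤ β j := by
    refine ⟨-∑ k ∈ Finset.range (n₀ + L), |β k|,
      le_of_le_on_window hp0.le hpos hsum hL hrec le_rfl fun j _ hj => ?_⟩
    have := Finset.single_le_sum (f := fun k => |β k|) (fun k _ => abs_nonneg _)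
      (Finset.mem_range.2 hj)
    exact (neg_le_neg this).trans (neg_abs_le _)
  by_contra! hcon
  have iter : ∀ r : ℕ, ∃ n ≥ n₀, ∀ j ≥ n, m + r * (p ^ (F + 2 * L) * c) ≤ β j := by
    intro r
    induction r with
    | zero => exact ⟨n₀, le_rfl, by simpa using hm⟩
    | succ r ih =>
      obtain ⟨n, hn, h⟩ := ih
      obtain ⟨j, hj, hjneg⟩ := hcon n
      obtain ⟨n', hn', h'⟩ := step n hn _ ((h j hj).trans hjneg.le) h
      refine ⟨n', hn', fun j hj => ?_⟩
      have := h' j hj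
      push_cast
      linarith
  obtain ⟨r, hr⟩ := Archimedean.arch (-m) hδ
  rw [nsmul_eq_mul] at hr
  obtain ⟨n, -, h⟩ := iter r
  obtain ⟨j, hj, hjneg⟩ := hcon n
  linarith [h j hj]

end Renewal

theorem exists_eq_sum_of_mem_Zring {p x : ℝ} (hx : x ∈ Zring p) :
    ∃ (a : ℕ → ℤ) (d : ℕ), (∀ k ≥ d, a k = 0) ∧
      ∀ n ≥ d, x = ∑ k ∈ Finset.range n, (a k : ℝ) * p ^ k := by
  obtain ⟨P, rfl⟩ : ∃ P : Polynomial ℤ, Polynomial.aeval p P = x := by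
    have h : Zring p ≤ (Polynomial.aeval (R := ℤ) p).toRingHom.range := by
      rw [Zring, Subring.closure_le, Set.singleton_subset_iff]
      exact ⟨Polynomial.X, Polynomial.aeval_X p⟩
    exact h hx
  refine ⟨P.coeff, P.natDegree + 1,
    fun k hk => Polynomial.coeff_eq_zero_of_natDegree_lt (by omega), fun n hn => ?_⟩
  rw [Polynomial.aeval_eq_sum_range' (n := n) (by omega)]
  simp

theorem pos_of_mem_Zplus {p x : ℝ} (hp : 0 < p) (hx : x ∈ Zplus {p}) : x ∈ Zring p ∧ 0 < x := by
  refine hx {x : ℝ | x ∈ Zring p ∧ 0 < x} ⟨?_, ?_, ?_, ?_⟩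
  · rintro _ rfl
    exact ⟨Subring.subset_closure rfl, hp⟩
  · exact fun n hn => ⟨natCast_mem _ n, by exact_mod_cast hn⟩
  · exact fun x hx y hy => ⟨add_mem hx.1 hy.1, add_pos hx.2 hy.2⟩
  · exact fun x hx y hy => ⟨mul_mem hx.1 hy.1, mul_pos hx.2 hy.2⟩

theorem int_mul_pow_eq_zero_or_mem_Zplus (p : ℝ) {b : ℤ} (hb : 0 ≤ b) (k : ℕ) :
    (b : ℝ) * p ^ k = 0 ∨ (b : ℝ) * p ^ k ∈ Zplus {p} := by
  lift b to ℕ using hb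
  rcases Nat.eq_zero_or_pos b with rfl | hb
  · simp
  · refine Or.inr fun T hT => ?_
    induction k with
    | zero => simpa using hT.2.1 b hb
    | succ k ih =>
      rw [pow_succ, ← mul_assoc]
      exact hT.2.2.2 _ ih _ (hT.1 rfl)

theorem add_eq_zero_or_mem_Zplus {s : Set ℝ} {x y : ℝ} (hx : x = 0 ∨ x ∈ Zplus s)
    (hy : y = 0 ∨ y ∈ Zplus s) : x + y = 0 ∨ x + y ∈ Zplus s := by
  rcases hx with rfl | hx
  · simpa using hy
  rcases hy with rfl | hy
  · simpa using Or.inr hx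
  · exact Or.inr fun T hT => hT.2.2.1 _ (hx T hT) _ (hy T hT)

/-- **Lemma.** Let `p ∈ (0,1)` with `p^{λ_1} + ⋯ + p^{λ_N} = 1` for positive integers
`λ_i` with `gcd(λ_1, …, λ_N) = 1`. Then the positive elements of `ℤ[p]` are exactly
the elements of `Z^+[p]`. -/
theorem pos_Zring_eq_Zplus (p : ℝ) (hp0 : 0 < p) (hp1 : p < 1)
    (N : ℕ) (hN : 0 < N) (lam : Fin N → ℕ) (hpos : ∀ i, 0 < lam i)
    (hgcd : Finset.univ.gcd lam = 1) (hsum : ∑ i, p ^ lam i = 1) :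
    {x : ℝ | x ∈ Zring p ∧ 0 < x} = Zplus {p} := by
  refine Set.Subset.antisymm ?_ fun x hx => pos_of_mem_Zplus hp0 hx
  rintro x ⟨hx, hx0⟩
  obtain ⟨a, d, ha, hxa⟩ := exists_eq_sum_of_mem_Zring hx
  set b := renewalSeq lam a
  set L := ∑ i, lam i
  have hL : ∀ i, lam i ≤ L := fun i =>
    Finset.single_le_sum (fun _ _ => Nat.zero_le _) (Finset.mem_univ i)
  have hL0 : 0 < L := (hpos ⟨0, hN⟩).trans_le (hL _)
  have hxb : ∀ n ≥ d, x = ∑ i, ∑ k ∈ Finset.Ico (n - lam i) n, (b k : ℝ) * p ^ (k + lam i) :=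
    fun n hn => (hxa n hn).trans (sum_range_eq_sum_renewalSeq hpos hsum a n)
  obtain ⟨n, hn⟩ := eventually_nonneg_of_recurrence (β := fun k => (b k : ℝ) * p ^ k)
    (n₀ := d + L) hp0 hp1 hpos hgcd hsum hL hL0
    (fun n hn => renewalSeq_mul_pow hpos (ha n (by omega)) fun i => (hL i).trans (by omega)) hx0
    (fun n hn => by
      rw [hxb n (by omega)]
      refine Finset.sum_congr rfl fun i _ => ?_
      rw [Finset.mul_sum]
      exact Finset.sum_congr rfl fun k _ => by ring)
  refine Or.resolve_left ?_ hx0.ne'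
  rw [hxb (n + d + L) (by omega)]
  refine Finset.sum_induction _ (fun y => y = 0 ∨ y ∈ Zplus {p})
    (fun _ _ => add_eq_zero_or_mem_Zplus) (Or.inl rfl) fun i _ => ?_
  refine Finset.sum_induction _ (fun y => y = 0 ∨ y ∈ Zplus {p})
    (fun _ _ => add_eq_zero_or_mem_Zplus) (Or.inl rfl) fun k hk => ?_
  rw [Finset.mem_Ico] at hk
  have h := hL i
  have hbk := nonneg_of_mul_nonneg_left (hn k (by omega)) (pow_pos hp0 k)
  exact int_mul_pow_eq_zero_or_mem_Zplus p (by exact_mod_cast hbk) _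

end
end

section
/- Let p ∈ (0,1) and suppose there exist positive integers λ_1, ..., λ_N (repetitions allowed) with gcd(λ_1, ..., λ_N) = 1 such that p^{λ_1} + p^{λ_2} + ... + p^{λ_N} = 1. Then h(Z[p]) ≤ h(Z[p^{−1}]); that is, the number of ideal classes of Z[p] is at most the number of ideal classes of Z[p^{−1}]. -/
open Pointwise

noncomputable section

/-- The underlying set of reals of an ideal of a subring of `ℝ`. -/
def idealSet {R : Subring ℝ} (I : Ideal R) : Set ℝ := (fun x : R => (x : ℝ)) '' (I : Set R)

/-- Two ideals of a subring `R` of `ℝ` lie in the same ideal class: `a·I = b·J`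
for some nonzero `a, b ∈ R`. -/
def SameIdealClass {R : Subring ℝ} (I J : Ideal R) : Prop :=
  ∃ a b : R, a ≠ 0 ∧ b ≠ 0 ∧ (a : ℝ) • idealSet I = (b : ℝ) • idealSet J

/-- The class number of a subring `R` of `ℝ`: the number of classes of nonzero ideals
of `R` under the ideal class relation. -/
def classNumber (R : Subring ℝ) : Cardinal :=
  Cardinal.mk (Quot fun I J : {I : Ideal R // I ≠ ⊥} => SameIdealClass I.1 J.1)

theorem inv_mem_Zring {p : ℝ} {N : ℕ} {lam : Fin N → ℕ} (hpos : ∀ i, 0 < lam i)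
    (hsum : ∑ i, p ^ lam i = 1) : p⁻¹ ∈ Zring p := by
  have h : p⁻¹ = ∑ i, p ^ (lam i - 1) := by
    refine inv_eq_of_mul_eq_one_right ?_
    rw [Finset.mul_sum, ← hsum]
    exact Finset.sum_congr rfl fun i _ => mul_pow_sub_one (hpos i).ne' p
  rw [h]
  have hp : p ∈ Zring p := Subring.subset_closure rfl
  exact sum_mem fun i _ => pow_mem hp _

theorem Zring_inv_le {p : ℝ} (h : p⁻¹ ∈ Zring p) : Zring p⁻¹ ≤ Zring p :=
  Subring.closure_le.2 (Set.singleton_subset_iff.2 h)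

/-- Every element of `ℤ[p]` is carried into `ℤ[p⁻¹]` by some power of `p⁻¹`. -/
theorem exists_mul_inv_pow_mem {p : ℝ} (hp : p ≠ 0) {x : ℝ} (hx : x ∈ Zring p) :
    ∃ n : ℕ, x * p⁻¹ ^ n ∈ Zring p⁻¹ := by
  have hq : p⁻¹ ∈ Zring p⁻¹ := Subring.subset_closure rfl
  induction hx using Subring.closure_induction with
  | mem x hx =>
    obtain rfl : x = p := hx
    exact ⟨1, by simp [hp, one_mem]⟩
  | zero => exact ⟨0, by simp [zero_mem]⟩
  | one => exact ⟨0, by simp [one_mem]⟩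
  | add x y _ _ hx hy =>
    obtain ⟨m, hm⟩ := hx
    obtain ⟨n, hn⟩ := hy
    refine ⟨m + n, ?_⟩
    have : (x + y) * p⁻¹ ^ (m + n) = x * p⁻¹ ^ m * p⁻¹ ^ n + y * p⁻¹ ^ n * p⁻¹ ^ m := by ring
    rw [this]
    exact add_mem (mul_mem hm (pow_mem hq n)) (mul_mem hn (pow_mem hq m))
  | neg x _ hx =>
    obtain ⟨m, hm⟩ := hx
    exact ⟨m, by rw [neg_mul]; exact neg_mem hm⟩
  | mul x y _ _ hx hy =>
    obtain ⟨m, hm⟩ := hx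
    obtain ⟨n, hn⟩ := hy
    refine ⟨m + n, ?_⟩
    have : x * y * p⁻¹ ^ (m + n) = x * p⁻¹ ^ m * (y * p⁻¹ ^ n) := by ring
    rw [this]
    exact mul_mem hm hn

/-- Every ideal of `ℤ[p]` is the extension of its contraction to `ℤ[p⁻¹]`. -/
theorem map_comap_inclusion_Zring {p : ℝ} (hp : p ≠ 0) (hle : Zring p⁻¹ ≤ Zring p)
    (I : Ideal (Zring p)) :
    (I.comap (Subring.inclusion hle)).map (Subring.inclusion hle) = I := by
  refine le_antisymm Ideal.map_comap_le fun x hx => ?_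
  obtain ⟨n, hn⟩ := exists_mul_inv_pow_mem hp x.2
  let P : Zring p := ⟨p, Subring.subset_closure rfl⟩
  let Q : Zring p := ⟨p⁻¹, hle (Subring.subset_closure rfl)⟩
  have hy : Subring.inclusion hle ⟨_, hn⟩ = x * Q ^ n := Subtype.ext rfl
  have hxy : x = Subring.inclusion hle ⟨_, hn⟩ * P ^ n := by
    have hQP : Q * P = 1 := Subtype.ext (inv_mul_cancel₀ hp)
    rw [hy, mul_assoc, ← mul_pow, hQP, one_pow, mul_one]
  rw [hxy]
  refine Ideal.mul_mem_right _ _ (Ideal.mem_map_of_mem _ ?_)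
  rw [Ideal.mem_comap, hy]
  exact I.mul_mem_right _ hx

theorem smul_idealSet_map_subset {R S : Subring ℝ} (hle : S ≤ R) {I J : Ideal S} {a b : S}
    (h : (a : ℝ) • idealSet I ⊆ (b : ℝ) • idealSet J) :
    (a : ℝ) • idealSet (I.map (Subring.inclusion hle)) ⊆
      (b : ℝ) • idealSet (J.map (Subring.inclusion hle)) := by
  rintro _ ⟨_, ⟨x, hx, rfl⟩, rfl⟩
  have key : ∃ y ∈ J.map (Subring.inclusion hle), (a : ℝ) * x = b * y := by
    refine Submodule.span_induction (p := fun (x : R) _ =>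
      ∃ y ∈ J.map (Subring.inclusion hle), (a : ℝ) * x = b * y) ?_ ?_ ?_ ?_ hx
    · rintro _ ⟨i, hi, rfl⟩
      obtain ⟨_, ⟨j, hj, rfl⟩, hij⟩ := h ⟨_, ⟨i, hi, rfl⟩, rfl⟩
      exact ⟨_, Ideal.mem_map_of_mem _ hj, hij.symm⟩
    · exact ⟨0, zero_mem _, by simp⟩
    · rintro x x' _ _ ⟨y, hy, h⟩ ⟨y', hy', h'⟩
      exact ⟨y + y', add_mem hy hy', by push_cast; rw [mul_add, mul_add, h, h']⟩
    · rintro r x _ ⟨y, hy, h⟩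
      refine ⟨r * y, Ideal.mul_mem_left _ _ hy, ?_⟩
      rw [smul_eq_mul]
      push_cast
      rw [mul_left_comm, h, mul_left_comm]
  obtain ⟨y, hy, hxy⟩ := key
  exact ⟨y, ⟨y, hy, rfl⟩, hxy.symm⟩

theorem SameIdealClass.map_inclusion {R S : Subring ℝ} (hle : S ≤ R) {I J : Ideal S}
    (h : SameIdealClass I J) :
    SameIdealClass (I.map (Subring.inclusion hle)) (J.map (Subring.inclusion hle)) := by
  obtain ⟨a, b, ha, hb, hab⟩ := h
  have hinj := Subring.inclusion_injective hle
  exact ⟨Subring.inclusion hle a, Subring.inclusion hle b,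
    (map_ne_zero_iff _ hinj).2 ha, (map_ne_zero_iff _ hinj).2 hb,
    (smul_idealSet_map_subset hle hab.subset).antisymm (smul_idealSet_map_subset hle hab.superset)⟩

/-- **Lemma.** Let `p ∈ (0,1)` with `p^{λ_1} + ⋯ + p^{λ_N} = 1` for positive integers
`λ_i` with `gcd(λ_1, …, λ_N) = 1`. Then `h(ℤ[p]) ≤ h(ℤ[p⁻¹])`. -/
theorem classNumber_le (p : ℝ) (hp0 : 0 < p) (hp1 : p < 1)
    (N : ℕ) (hN : 0 < N) (lam : Fin N → ℕ) (hpos : ∀ i, 0 < lam i)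
    (hgcd : Finset.univ.gcd lam = 1) (hsum : ∑ i, p ^ lam i = 1) :
    classNumber (Zring p) ≤ classNumber (Zring p⁻¹) := by
  have hle := Zring_inv_le (inv_mem_Zring hpos hsum)
  refine Cardinal.mk_le_of_surjective (f := Quot.map
    (fun I => ⟨I.1.map (Subring.inclusion hle), fun h => I.2 <|
      (Ideal.map_eq_bot_iff_of_injective (Subring.inclusion_injective hle)).1 h⟩)
    fun I J h => h.map_inclusion hle) ?_
  rintro ⟨I, hI⟩
  have hmap := map_comap_inclusion_Zring hp0.ne' hle I
  refine ⟨Quot.mk _ ⟨I.comap (Subring.inclusion hle), fun h => hI ?_⟩, ?_⟩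
  · rw [← hmap, h, Ideal.map_bot]
  · exact congrArg (Quot.mk _) (Subtype.ext hmap)

end
end

section
/- Let n ≥ 1 and let ξ_1, ..., ξ_n be nonnegative integers with ξ_n > 0, and let λ_1, ..., λ_m be exactly the indices i with ξ_i > 0; assume gcd(λ_1, ..., λ_m) = 1. Let Ξ be the n×n matrix whose first column is (ξ_1, ..., ξ_n)^T, whose (i, i+1)-entries equal 1 for 1 ≤ i ≤ n−1, and whose all other entries are 0. Then Ξ is primitive, i.e., some power Ξ^k (k ≥ 1) has all entries strictly positive. Moreover, if p is the unique positive solution of ξ_1·p + ξ_2·p^2 + ... + ξ_n·p^n = 1, then the row vector v = (1, p, p^2, ..., p^{n−1}) satisfies v·Ξ = p^{−1}·v; in other words, p^{−1} is the Perron–Frobenius eigenvalue of Ξ and v is a corresponding left eigenvector. -/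
noncomputable section

/-- The matrix `Ξ`: first column `(ξ_1, …, ξ_n)ᵀ`, entries `1` on the superdiagonal
`(i, i+1)`, and `0` elsewhere. -/
def XiMatrix (n : ℕ) (ξ : Fin n → ℕ) : Matrix (Fin n) (Fin n) ℝ :=
  Matrix.of fun i j =>
    if (j : ℕ) = 0 then (ξ i : ℝ) else if (j : ℕ) = (i : ℕ) + 1 then 1 else 0

/-- Walks of positive weight in a nonnegative matrix can be concatenated. -/
theorem Matrix.pow_add_apply_pos {ι R : Type*} [Fintype ι] [DecidableEq ι]
    [Semiring R] [PartialOrder R] [IsStrictOrderedRing R] {A : Matrix ι ι R}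
    (hA : ∀ i j, 0 ≤ A i j) {a b : ℕ} {i l j : ι}
    (hil : 0 < (A ^ a) i l) (hlj : 0 < (A ^ b) l j) : 0 < (A ^ (a + b)) i j := by
  rw [pow_add, Matrix.mul_apply]
  exact Finset.sum_pos'
    (fun t _ => mul_nonneg (Matrix.pow_apply_nonneg hA a i t)
      (Matrix.pow_apply_nonneg hA b t j))
    ⟨l, Finset.mem_univ l, mul_pos hil hlj⟩

/-- The lengths of closed walks of positive weight at `i` in a nonnegative matrix. -/
def Matrix.returnTimes {ι R : Type*} [Fintype ι] [DecidableEq ι]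
    [Semiring R] [PartialOrder R] [IsStrictOrderedRing R] (A : Matrix ι ι R)
    (hA : ∀ i j, 0 ≤ A i j) (i : ι) : AddSubmonoid ℕ where
  carrier := {k | 0 < (A ^ k) i i}
  zero_mem' := by simp
  add_mem' := Matrix.pow_add_apply_pos hA

theorem xiMatrix_nonneg {n : ℕ} (ξ : Fin n → ℕ) (i j : Fin n) : 0 ≤ XiMatrix n ξ i j := by
  simp only [XiMatrix, Matrix.of_apply]
  split_ifs <;> positivity

/-- The superdiagonal connects `i` to `j` in `j - i` steps. -/
theorem xiMatrix_pow_apply_pos_of_add_eq {n : ℕ} (ξ : Fin n → ℕ) (m : ℕ) (i j : Fin n)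
    (hij : (i : ℕ) + m = j) : 0 < (XiMatrix n ξ ^ m) i j := by
  induction m generalizing j with
  | zero =>
    obtain rfl : i = j := Fin.ext hij
    simp
  | succ m ih =>
    refine Matrix.pow_add_apply_pos (xiMatrix_nonneg ξ)
      (ih ⟨i + m, by omega⟩ rfl) ?_
    have hj : (j : ℕ) ≠ 0 := by omega
    have hj' : (j : ℕ) = i + m + 1 := by omega
    rw [pow_one, XiMatrix, Matrix.of_apply, if_neg hj, if_pos hj']
    exact one_pos

/-- If `ξ l > 0`, then `0` can be reached from every `i ≤ l` in `l - i + 1` steps. -/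
theorem xiMatrix_pow_apply_zero_pos {n : ℕ} [NeZero n] {ξ : Fin n → ℕ} {l : Fin n}
    (hl : 0 < ξ l) {m : ℕ} {i : Fin n} (hil : (i : ℕ) + m = l) :
    0 < (XiMatrix n ξ ^ (m + 1)) i 0 := by
  refine Matrix.pow_add_apply_pos (xiMatrix_nonneg ξ)
    (xiMatrix_pow_apply_pos_of_add_eq ξ m i l hil) ?_
  simpa [XiMatrix] using hl

theorem xiMatrix_exists_pow_pos {n : ℕ} [NeZero n] {ξ : Fin n → ℕ} {l : Fin n}
    (hl : 0 < ξ l) (hl_max : (l : ℕ) + 1 = n)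
    (hgcd : (Finset.univ.filter fun i : Fin n => 0 < ξ i).gcd (fun i => (i : ℕ) + 1) = 1) :
    ∃ k : ℕ, 1 ≤ k ∧ ∀ i j : Fin n, 0 < (XiMatrix n ξ ^ k) i j := by
  set s : Set ℕ := {k | ∃ i : Fin n, 0 < ξ i ∧ (i : ℕ) + 1 = k}
  have hs : Nat.setGcd s = 1 := by
    refine Nat.dvd_one.mp (hgcd ▸ Finset.dvd_gcd fun i hi => Nat.setGcd_dvd_of_mem ?_)
    exact ⟨i, (Finset.mem_filter.mp hi).2, rfl⟩
  have hclosure : AddSubmonoid.closure s ≤ (XiMatrix n ξ).returnTimes (xiMatrix_nonneg ξ) 0 := by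
    rw [AddSubmonoid.closure_le]
    rintro _ ⟨i, hi, rfl⟩
    exact xiMatrix_pow_apply_zero_pos hi (by simp)
  obtain ⟨N, hN⟩ := Nat.exists_mem_closure_of_ge s
  have hreturn : ∀ k ≥ N, 0 < (XiMatrix n ξ ^ k) 0 0 := fun k hk =>
    hclosure (hN k hk (hs ▸ one_dvd k))
  refine ⟨n + N + n, by omega, fun i j => ?_⟩
  have hi := i.isLt
  have hj := j.isLt
  have hk : n + N + n = (l - i + 1) + (N + i + n - j) + j := by omega
  rw [hk]
  exact Matrix.pow_add_apply_pos (xiMatrix_nonneg ξ)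
    (Matrix.pow_add_apply_pos (xiMatrix_nonneg ξ)
      (xiMatrix_pow_apply_zero_pos hl (by omega)) (hreturn _ (by omega)))
    (xiMatrix_pow_apply_pos_of_add_eq ξ j 0 j (by simp))

theorem xiMatrix_vecMul_pow {n : ℕ} {ξ : Fin n → ℕ} {p : ℝ} (hp : p ≠ 0)
    (hsum : ∑ i : Fin n, (ξ i : ℝ) * p ^ ((i : ℕ) + 1) = 1) :
    Matrix.vecMul (fun i : Fin n => p ^ (i : ℕ)) (XiMatrix n ξ) =
      p⁻¹ • fun i : Fin n => p ^ (i : ℕ) := by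
  funext j
  rw [Pi.smul_apply, smul_eq_mul, eq_inv_mul_iff_mul_eq₀ hp, Matrix.vecMul, dotProduct]
  by_cases hj : (j : ℕ) = 0
  · simp only [XiMatrix, Matrix.of_apply, hj, if_true, pow_zero]
    rw [Finset.mul_sum]
    refine Eq.trans ?_ hsum
    exact Finset.sum_congr rfl fun i _ => by ring
  · have hj' := j.isLt
    rw [Finset.sum_eq_single (⟨j - 1, by omega⟩ : Fin n)]
    · have hpred : (j : ℕ) = j - 1 + 1 := by omega
      simp only [XiMatrix, Matrix.of_apply, if_neg hj, if_pos hpred, mul_one]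
      rw [← pow_succ', ← hpred]
    · intro i _ hi
      have hne : (j : ℕ) ≠ i + 1 := fun h => hi (Fin.ext (by simp [h]))
      simp [XiMatrix, hj, hne]
    · simp

/-- **Lemma.** Let `ξ_1, …, ξ_n` be nonnegative integers with `ξ_n > 0`, and suppose
the indices `i` with `ξ_i > 0` have gcd `1`. Then `Ξ` is primitive (some power has all
entries positive); moreover, if `p > 0` satisfies `ξ_1·p + ξ_2·p² + ⋯ + ξ_n·pⁿ = 1`,
then the row vector `v = (1, p, …, p^{n-1})` satisfies `v ᵥ* Ξ = p⁻¹ • v`, i.e. `p⁻¹`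
is the Perron–Frobenius eigenvalue of `Ξ` with left eigenvector `v`. -/
theorem xiMatrix_primitive_and_eigen (n : ℕ) (hn : 1 ≤ n) (ξ : Fin n → ℕ)
    (hlast : 0 < ξ ⟨n - 1, by omega⟩)
    (hgcd : Finset.gcd (Finset.univ.filter fun i : Fin n => 0 < ξ i)
        (fun i => (i : ℕ) + 1) = 1)
    (p : ℝ) (hp : 0 < p)
    (hsum : ∑ i : Fin n, (ξ i : ℝ) * p ^ ((i : ℕ) + 1) = 1) :
    (∃ k : ℕ, 1 ≤ k ∧ ∀ i j : Fin n, 0 < (XiMatrix n ξ ^ k) i j) ∧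
      Matrix.vecMul (fun i : Fin n => p ^ (i : ℕ)) (XiMatrix n ξ) =
        p⁻¹ • fun i : Fin n => p ^ (i : ℕ) := by
  have : NeZero n := ⟨by omega⟩
  exact ⟨xiMatrix_exists_pow_pos hlast (Nat.sub_add_cancel hn) hgcd,
    xiMatrix_vecMul_pow hp.ne' hsum⟩

end
end

section
/- Let p, r ∈ (0,1) with TOEC(p,r) ≠ ∅. Then for every nonzero ideal I of the ring Z[p] there exists an IFS S ∈ TOEC(p,r) such that I_S = I. -/
open MeasureTheory Metric Set Pointwise

noncomputable section

/-- An iterated function system (IFS) of contracting similarities on `ℝ^d`. -/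
structure IFS (d : ℕ) : Type 1 where
  ι : Type
  fin : Fintype ι
  f : ι → EuclideanSpace ℝ (Fin d) → EuclideanSpace ℝ (Fin d)
  r : ι → ℝ
  r_pos : ∀ i, 0 < r i
  r_lt_one : ∀ i, r i < 1
  sim : ∀ i x y, dist (f i x) (f i y) = r i * dist x y

attribute [instance] IFS.fin

namespace IFS

variable {d : ℕ}

/-- `E` is the self-similar set (attractor) of `S`: the unique nonempty compact set
with `E = ⋃ i, S.f i '' E`. -/
def IsAttractor (S : IFS d) (E : Set (EuclideanSpace ℝ (Fin d))) : Prop :=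
  E.Nonempty ∧ IsCompact E ∧ E = ⋃ i, S.f i '' E

open scoped Classical in
/-- The self-similar set generated by `S`. -/
def attractor (S : IFS d) : Set (EuclideanSpace ℝ (Fin d)) :=
  if h : ∃ E, S.IsAttractor E then h.choose else ∅

/-- `O` is an open set witnessing the open set condition for `S`. -/
def OSCSet (S : IFS d) (O : Set (EuclideanSpace ℝ (Fin d))) : Prop :=
  O.Nonempty ∧ IsOpen O ∧ Bornology.IsBounded O ∧
    (∀ i, S.f i '' O ⊆ O) ∧ ∀ i j, i ≠ j → Disjoint (S.f i '' O) (S.f j '' O)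

/-- The open set condition. -/
def OSC (S : IFS d) : Prop := ∃ O, S.OSCSet O

/-- The strong separation condition. -/
def SSC (S : IFS d) : Prop :=
  ∀ i j : S.ι, i ≠ j → Disjoint (S.f i '' S.attractor) (S.f j '' S.attractor)

/-- `r` is the ratio root of `S`: the ratios are commensurable with common root `r`. -/
def IsRatioRoot (S : IFS d) (r : ℝ) : Prop :=
  0 < r ∧ r < 1 ∧
    ∃ lam : S.ι → ℕ, (∀ i, 0 < lam i) ∧ (∀ i, S.r i = r ^ lam i) ∧ Finset.univ.gcd lam = 1

/-- The Hausdorff dimension of the attractor of `S`, as a real number. -/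
def hdim (S : IFS d) : ℝ := (dimH S.attractor).toReal

/-- Membership in the class TOEC: OSC, commensurable ratios, totally disconnected attractor. -/
def MemTOEC (S : IFS d) : Prop :=
  S.OSC ∧ (∃ r, S.IsRatioRoot r) ∧ IsTotallyDisconnected S.attractor

/-- Membership in TOEC(p, r): measure root `p` and ratio root `r`. -/
def MemTOECpr (S : IFS d) (p r : ℝ) : Prop :=
  S.MemTOEC ∧ S.IsRatioRoot r ∧ p = r ^ S.hdim

/-- The natural measure of a set: normalized `s`-dimensional Hausdorff measure, `s = dimH E_S`. -/
def natMeasure (S : IFS d) (F : Set (EuclideanSpace ℝ (Fin d))) : ℝ :=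
  (μH[S.hdim] F / μH[S.hdim] S.attractor).toReal

/-- `F` is an interior separated set of `E_S`. -/
def IsIntSep (S : IFS d) (F : Set (EuclideanSpace ℝ (Fin d))) : Prop :=
  IsCompact F ∧ F ⊆ S.attractor ∧ IsCompact (S.attractor \ F) ∧ ∃ O, S.OSCSet O ∧ F ⊆ O

end IFS

/-- The ideal `I_S` of `ℤ[p]` generated by the natural measures of interior separated sets. -/
def IFS.idealOf {d : ℕ} (S : IFS d) (p : ℝ) : Ideal (Zring p) :=
  Ideal.span {x : Zring p | ∃ F, S.IsIntSep F ∧ (x : ℝ) = S.natMeasure F}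

/-- Lipschitz equivalence of subsets of (possibly different) metric spaces. -/
def LipEquiv {X Y : Type*} [MetricSpace X] [MetricSpace Y] (A : Set X) (B : Set Y) : Prop :=
  ∃ (f : X → Y) (L : ℝ), 1 ≤ L ∧ Set.BijOn f A B ∧
    ∀ x ∈ A, ∀ y ∈ A, L⁻¹ * dist x y ≤ dist (f x) (f y) ∧ dist (f x) (f y) ≤ L * dist x y


/-! ### Arithmetic of `ℤ[p]` -/

section Arithmetic

open Polynomial

/-- If `∑ p ^ lam i = 1` with coprime exponents, every large exponent occurs in some
representation of `1` as a sum of powers of `p`. -/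
lemma exists_pow_add_aeval_eq_one {κ : Type*} [Fintype κ] {p : ℝ} {lam : κ → ℕ}
    (hsum : ∑ i, p ^ lam i = 1) (hgcd : Finset.univ.gcd lam = 1) :
    ∃ n₀, ∀ n ≥ n₀, ∃ R : ℕ[X], p ^ n + aeval p R = 1 := by
  classical
  obtain ⟨n₀, h⟩ := Nat.exists_mem_closure_of_ge (Set.range lam)
  refine ⟨n₀, fun n hn => ?_⟩
  have hdvd : Nat.setGcd (Set.range lam) ∣ n := by
    have : Nat.setGcd (Set.range lam) ∣ Finset.univ.gcd lam :=
      Finset.dvd_gcd fun i _ => Nat.setGcd_dvd_of_mem ⟨i, rfl⟩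
    exact (this.trans (hgcd ▸ dvd_rfl)).trans (one_dvd n)
  have hmem := h n hn hdvd
  clear hn hdvd h
  induction hmem using AddSubmonoid.closure_induction with
  | mem x hx =>
    obtain ⟨i, rfl⟩ := hx
    refine ⟨∑ j ∈ Finset.univ.erase i, X ^ lam j, ?_⟩
    rw [map_sum]
    simp only [map_pow, aeval_X]
    rw [Finset.add_sum_erase _ (fun j => p ^ lam j) (Finset.mem_univ i), hsum]
  | zero => exact ⟨0, by simp⟩
  | add x y _ _ hx hy =>
    obtain ⟨R, hR⟩ := hx
    obtain ⟨Q, hQ⟩ := hy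
    refine ⟨X ^ x * Q + R * X ^ y + R * Q, ?_⟩
    simp only [map_add, map_mul, map_pow, aeval_X]
    calc _ = (p ^ x + aeval p R) * (p ^ y + aeval p Q) := by ring
      _ = 1 := by rw [hR, hQ, one_mul]

/-- Any prescribed polynomial with natural coefficients, shifted far enough, occurs in some
representation of `1` as a sum of powers of `p`. -/
lemma exists_pow_mul_aeval_add_aeval_eq_one {κ : Type*} [Fintype κ] {p : ℝ} {lam : κ → ℕ}
    (hp1 : p < 1) (hp0 : 0 < p) (hlam : ∀ i, 0 < lam i)
    (hsum : ∑ i, p ^ lam i = 1) (hgcd : Finset.univ.gcd lam = 1) (T : ℕ[X]) :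
    ∃ n₀, ∀ n ≥ n₀, ∃ R : ℕ[X], p ^ n * aeval p T + aeval p R = 1 := by
  classical
  obtain ⟨i, j, hij⟩ : ∃ i j : κ, i ≠ j := by
    by_contra! hcon
    have : Subsingleton κ := ⟨hcon⟩
    rcases isEmpty_or_nonempty κ with hE | ⟨⟨i⟩⟩
    · simp at hsum
    · rw [Fintype.sum_subsingleton _ i] at hsum
      exact (pow_lt_one₀ hp0.le hp1 (hlam i).ne').ne hsum
  have hadd : ∀ T₁ T₂ : ℕ[X],
      (∃ n₀, ∀ n ≥ n₀, ∃ R : ℕ[X], p ^ n * aeval p T₁ + aeval p R = 1) →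
      (∃ n₀, ∀ n ≥ n₀, ∃ R : ℕ[X], p ^ n * aeval p T₂ + aeval p R = 1) →
      ∃ n₀, ∀ n ≥ n₀, ∃ R : ℕ[X], p ^ n * aeval p (T₁ + T₂) + aeval p R = 1 := by
    rintro T₁ T₂ ⟨n₁, h₁⟩ ⟨n₂, h₂⟩
    refine ⟨n₁ + n₂ + lam i + lam j, fun n hn => ?_⟩
    obtain ⟨R₁, hR₁⟩ := h₁ (n - lam i) (by omega)
    obtain ⟨R₂, hR₂⟩ := h₂ (n - lam j) (by omega)
    refine ⟨X ^ lam i * R₁ + X ^ lam j * R₂ +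
      ∑ l ∈ (Finset.univ.erase i).erase j, X ^ lam l, ?_⟩
    have e₁ : p ^ n = p ^ lam i * p ^ (n - lam i) := by rw [← pow_add]; congr 1; omega
    have e₂ : p ^ n = p ^ lam j * p ^ (n - lam j) := by rw [← pow_add]; congr 1; omega
    have hs : p ^ lam i + (p ^ lam j + ∑ l ∈ (Finset.univ.erase i).erase j, p ^ lam l) = 1 := by
      rw [Finset.add_sum_erase _ (fun l => p ^ lam l) (by simp [hij.symm]),
        Finset.add_sum_erase _ (fun l => p ^ lam l) (Finset.mem_univ i), hsum]
    simp only [map_add, map_mul, map_pow, map_sum, aeval_X]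
    rw [mul_add]
    nth_rewrite 1 [e₁]
    rw [e₂]
    linear_combination p ^ lam i * hR₁ + p ^ lam j * hR₂ + hs
  induction T using Polynomial.induction_on' with
  | add T₁ T₂ h₁ h₂ => exact hadd T₁ T₂ h₁ h₂
  | monomial m a =>
    induction a with
    | zero =>
      refine ⟨0, fun n _ => ⟨1, ?_⟩⟩
      simp
    | succ a ih =>
      rw [(monomial m).map_add]
      refine hadd _ _ ih ?_
      obtain ⟨n₀, h⟩ := exists_pow_add_aeval_eq_one hsum hgcd
      refine ⟨n₀, fun n hn => ?_⟩
      obtain ⟨R, hR⟩ := h (n + m) (by omega)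
      refine ⟨R, ?_⟩
      rw [← C_mul_X_pow_eq_monomial]
      simp only [map_one, one_mul, map_pow, aeval_X]
      rw [← pow_add, hR]

lemma mem_Zring_self (p : ℝ) : p ∈ Zring p := Subring.subset_closure rfl

lemma aeval_mem_Zring (p : ℝ) (A : ℕ[X]) : aeval p A ∈ Zring p := by
  rw [aeval_eq_sum_range]
  refine Subring.sum_mem _ fun i _ => ?_
  rw [nsmul_eq_mul]
  exact Subring.mul_mem _ (natCast_mem _ _) (Subring.pow_mem _ (mem_Zring_self p) _)

/-- Every element of `ℤ[p]` is a difference of two sums of powers of `p`. -/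
lemma exists_aeval_sub_aeval {p x : ℝ} (hx : x ∈ Zring p) :
    ∃ A B : ℕ[X], x = aeval p A - aeval p B := by
  induction hx using Subring.closure_induction with
  | mem x hx => exact ⟨X, 0, by simpa using hx⟩
  | zero => exact ⟨0, 0, by simp⟩
  | one => exact ⟨1, 0, by simp⟩
  | add x y _ _ hx hy =>
    obtain ⟨A, B, rfl⟩ := hx
    obtain ⟨A', B', rfl⟩ := hy
    exact ⟨A + A', B + B', by simp only [map_add]; ring⟩
  | neg x _ hx =>
    obtain ⟨A, B, rfl⟩ := hx
    exact ⟨B, A, by ring⟩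
  | mul x y _ _ hx hy =>
    obtain ⟨A, B, rfl⟩ := hx
    obtain ⟨A', B', rfl⟩ := hy
    exact ⟨A * A' + B * B', A * B' + B * A', by simp only [map_add, map_mul]; ring⟩

/-- The generator `p` of `ℤ[p]`. -/
def Zring.gen (p : ℝ) : Zring p := ⟨p, mem_Zring_self p⟩

/-- The value at `p` of a polynomial with natural coefficients, as an element of `ℤ[p]`. -/
def Zring.ofNatPoly (p : ℝ) (A : ℕ[X]) : Zring p := ⟨aeval p A, aeval_mem_Zring p A⟩

lemma Zring.isNoetherianRing (p : ℝ) : IsNoetherianRing (Zring p) := by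
  refine isNoetherianRing_of_surjective ℤ[X] (Zring p) (aeval (Zring.gen p)).toRingHom ?_
  rintro ⟨x, hx⟩
  obtain ⟨A, B, h⟩ := exists_aeval_sub_aeval hx
  refine ⟨A.map (Nat.castRingHom ℤ) - B.map (Nat.castRingHom ℤ), Subtype.ext ?_⟩
  have key : ∀ C : ℕ[X], ((aeval (Zring.gen p) (C.map (Nat.castRingHom ℤ)) : Zring p) : ℝ) =
      aeval p C := by
    intro C
    rw [aeval_def, eval₂_map, aeval_def, ← Subring.coe_subtype, hom_eval₂]
    congr 1
  simp only [AlgHom.toRingHom_eq_coe, RingHom.coe_coe, map_sub]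
  rw [AddSubgroupClass.coe_sub, key, key, h]

variable {κ : Type*} [Fintype κ] {p : ℝ} {lam : κ → ℕ}

lemma Zring.exists_inverse (hlam : ∀ i, 0 < lam i) (hsum : ∑ i, p ^ lam i = 1) :
    ∃ y : Zring p, Zring.gen p * y = 1 ∧ IsIntegral ℤ y := by
  classical
  set x := Zring.gen p with hx
  have hx1 : ∑ i, x ^ lam i = 1 := by
    apply Subtype.ext
    simpa [hx, Zring.gen] using hsum
  set y : Zring p := ∑ i, x ^ (lam i - 1)
  have hxy : x * y = 1 := by
    rw [← hx1, Finset.mul_sum]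
    refine Finset.sum_congr rfl fun i _ => ?_
    rw [← pow_succ', Nat.sub_add_cancel (hlam i)]
  refine ⟨y, hxy, ?_⟩
  set L := ∑ i, lam i + 1
  have hL : ∀ i, lam i < L := fun i =>
    Nat.lt_succ_of_le (Finset.single_le_sum (fun _ _ => Nat.zero_le _) (Finset.mem_univ i))
  refine ⟨X ^ L - ∑ i, X ^ (L - lam i), ?_, ?_⟩
  · refine monic_X_pow_sub ?_
    refine (degree_sum_le _ _).trans_lt ?_
    refine (Finset.sup_lt_iff (WithBot.bot_lt_coe L)).2 fun i _ => ?_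
    rw [degree_X_pow]
    have := hL i
    have := hlam i
    exact WithBot.coe_lt_coe.2 (by omega : L - lam i < L)
  · simp only [eval₂_sub, eval₂_pow, eval₂_X, eval₂_finsetSum]
    rw [sub_eq_zero]
    calc y ^ L = y ^ L * ∑ i, x ^ lam i := by rw [hx1, mul_one]
      _ = ∑ i, y ^ (L - lam i) := by
        rw [Finset.mul_sum]
        refine Finset.sum_congr rfl fun i _ => ?_
        have e : y ^ L = y ^ (L - lam i) * y ^ lam i := by
          rw [← pow_add, Nat.sub_add_cancel (hL i).le]
        rw [e, mul_assoc, ← mul_pow, mul_comm y x, hxy, one_pow, mul_one]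

lemma Zring.exists_natCast_mem (hlam : ∀ i, 0 < lam i) (hsum : ∑ i, p ^ lam i = 1)
    {I : Ideal (Zring p)} (hI : I ≠ ⊥) : ∃ N : ℕ, 0 < N ∧ (N : Zring p) ∈ I := by
  obtain ⟨y, hxy, hy⟩ := Zring.exists_inverse hlam hsum
  have hyR : IsAlgebraic ℤ (y : ℝ) :=
    (hy.isAlgebraic).algHom ((Zring p).subtype.toIntAlgHom)
  have hpy : p = (y : ℝ)⁻¹ := by
    have := congrArg Subtype.val hxy
    exact eq_inv_of_mul_eq_one_left this
  have hpalg : IsAlgebraic ℤ p := hpy ▸ hyR.inv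
  have hall : ∀ x ∈ Zring p, IsAlgebraic ℤ x := by
    intro x hx
    induction hx using Subring.closure_induction with
    | mem x hx => rw [Set.mem_singleton_iff.mp hx]; exact hpalg
    | zero => exact isAlgebraic_zero
    | one => exact isAlgebraic_one
    | add x y _ _ hx hy => exact hx.add hy
    | neg x _ hx => exact hx.neg
    | mul x y _ _ hx hy => exact hx.mul hy
  obtain ⟨b, hbI, hb0⟩ := Submodule.exists_mem_ne_zero_of_ne_bot hI
  have hb : IsAlgebraic ℤ b := by
    have := hall b b.2
    exact (isAlgebraic_algHom_iff ((Zring p).subtype.toIntAlgHom) Subtype.val_injective).1 this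
  have hne := Ideal.comap_ne_bot_of_algebraic_mem hb0 hbI hb
  obtain ⟨m, hm, hm0⟩ := Submodule.exists_mem_ne_zero_of_ne_bot hne
  refine ⟨m.natAbs, Int.natAbs_pos.2 hm0, ?_⟩
  have hm' : (m : Zring p) ∈ I := by simpa using hm
  rcases Int.natAbs_eq m with h | h
  · rw [h] at hm'; simpa using hm'
  · rw [h] at hm'
    have := I.neg_mem hm'
    simpa using this

/-- Some positive power of `p` is congruent to `1` modulo a given nonzero ideal of `ℤ[p]`. -/
lemma Zring.exists_pow_sub_one_mem (hlam : ∀ i, 0 < lam i) (hsum : ∑ i, p ^ lam i = 1)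
    {I : Ideal (Zring p)} (hI : I ≠ ⊥) : ∃ n, 0 < n ∧ Zring.gen p ^ n - 1 ∈ I := by
  obtain ⟨y, hxy, hy⟩ := Zring.exists_inverse hlam hsum
  obtain ⟨N, hN, hNI⟩ := Zring.exists_natCast_mem hlam hsum hI
  set q := Ideal.Quotient.mk I
  have hyq : IsIntegral ℤ (q y) := hy.map q.toIntAlgHom
  have hfin : Module.Finite ℤ (Algebra.adjoin ℤ {q y}) :=
    Module.Finite.iff_fg.2 hyq.fg_adjoin_singleton
  have htor : Module.IsTorsion ℤ (Algebra.adjoin ℤ {q y}) := by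
    intro z
    refine ⟨⟨(N : ℤ), mem_nonZeroDivisors_of_ne_zero (by exact_mod_cast hN.ne')⟩, ?_⟩
    apply Subtype.ext
    have h0 : q (N : Zring p) = 0 := Ideal.Quotient.eq_zero_iff_mem.2 hNI
    have : ((N : ℕ) : Zring p ⧸ I) = 0 := by simpa using h0
    change ((N : ℤ) • z.1) = 0
    rw [zsmul_eq_mul]
    push_cast
    rw [this, zero_mul]
  have : Finite (Algebra.adjoin ℤ {q y}) := Module.finite_of_fg_torsion _ htor
  obtain ⟨a, b, hab, he⟩ := Finite.exists_ne_map_eq_of_infinite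
    (fun n : ℕ => (⟨q y, Algebra.self_mem_adjoin_singleton ℤ (q y)⟩ :
      Algebra.adjoin ℤ {q y}) ^ n)
  have he' : q y ^ a = q y ^ b := by simpa using congrArg Subtype.val he
  have hxyq : q (Zring.gen p) * q y = 1 := by rw [← map_mul, hxy, map_one]
  have main : ∀ a b : ℕ, a < b → q y ^ a = q y ^ b → ∃ n, 0 < n ∧ Zring.gen p ^ n - 1 ∈ I := by
    intro a b hab he
    refine ⟨b - a, by omega, ?_⟩
    rw [← Ideal.Quotient.eq_zero_iff_mem, map_sub, map_pow, map_one, sub_eq_zero]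
    have e : q (Zring.gen p) ^ b * q y ^ a = q (Zring.gen p) ^ b * q y ^ b := by rw [he]
    rw [← mul_pow _ _ b, hxyq, one_pow] at e
    rw [← e]
    have : q (Zring.gen p) ^ b = q (Zring.gen p) ^ (b - a) * q (Zring.gen p) ^ a := by
      rw [← pow_add]; congr 1; omega
    change q (Zring.gen p) ^ (b - a) = _
    rw [this, mul_assoc, ← mul_pow, hxyq, one_pow, mul_one]
  rcases lt_or_gt_of_ne hab with h | h
  · exact main a b h he'
  · exact main b a h he'.symm

/-- A nonzero ideal of `ℤ[p]` is generated by finitely many sums of powers of `p`. -/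
lemma Zring.exists_finset_span (hlam : ∀ i, 0 < lam i) (hsum : ∑ i, p ^ lam i = 1)
    {I : Ideal (Zring p)} (hI : I ≠ ⊥) :
    ∃ s : Finset ℕ[X], Ideal.span (Zring.ofNatPoly p '' s) = I := by
  classical
  have := Zring.isNoetherianRing p
  obtain ⟨N, hN, hNI⟩ := Zring.exists_natCast_mem hlam hsum hI
  set Y : Set (Zring p) := {x | x ∈ I ∧ ∃ A, x = Zring.ofNatPoly p A}
  have hY : Ideal.span Y = I := by
    refine le_antisymm (Ideal.span_le.2 fun x hx => hx.1) fun x hx => ?_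
    obtain ⟨A, B, h⟩ := exists_aeval_sub_aeval x.2
    have hNY : (N : Zring p) ∈ Y := ⟨hNI, (N : ℕ[X]), Subtype.ext (by simp [Zring.ofNatPoly])⟩
    have hx' : x + N * Zring.ofNatPoly p B ∈ Y := by
      refine ⟨I.add_mem hx (I.mul_mem_right _ hNI), A + (N - 1 : ℕ) * B, Subtype.ext ?_⟩
      simp only [Zring.ofNatPoly, Subring.coe_add, Subring.coe_mul, map_add, map_mul, map_natCast,
        h, Subring.coe_natCast, Nat.cast_sub (show 1 ≤ N from hN)]
      push_cast
      ring
    have e : x = (x + N * Zring.ofNatPoly p B) - Zring.ofNatPoly p B * N := by ring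
    rw [e]
    exact Ideal.sub_mem _ (Ideal.subset_span hx')
      (Ideal.mul_mem_left _ _ (Ideal.subset_span hNY))
  have hfg : (Submodule.span (Zring p) Y).FG := IsNoetherian.noetherian _
  obtain ⟨s', hs', he⟩ := (Submodule.fg_span_iff_fg_span_finset_subset Y).1 hfg
  choose! A hA using fun x (hx : x ∈ Y) => hx.2
  refine ⟨s'.image A, ?_⟩
  rw [← hY]
  change _ = Submodule.span (Zring p) Y
  rw [he]
  change Submodule.span _ _ = _
  congr 1
  ext x
  simp only [Finset.coe_image, Set.mem_image, Finset.mem_coe, exists_exists_and_eq_and]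
  constructor
  · rintro ⟨y, hy, rfl⟩
    rw [← hA y (hs' hy)]
    exact hy
  · exact fun hx => ⟨x, hx, (hA x (hs' hx)).symm⟩

/-- A representation of `1` as a power of `p` plus sums of powers of `p` generating a given
ideal, with all exponents large. -/
lemma Zring.exists_polynomials (hp0 : 0 < p) (hp1 : p < 1) (hlam : ∀ i, 0 < lam i)
    (hsum : ∑ i, p ^ lam i = 1) (hgcd : Finset.univ.gcd lam = 1)
    {I : Ideal (Zring p)} (hI : I ≠ ⊥) (m₀ : ℕ) :
    ∃ (n : ℕ) (s : Finset ℕ[X]) (A : Option s → ℕ[X]), m₀ ≤ n ∧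
      p ^ n + ∑ c, aeval p (A c) = 1 ∧ (∀ c, ∀ j < m₀, (A c).coeff j = 0) ∧
      Ideal.span (Set.range fun c => Zring.ofNatPoly p (A c)) = I ∧
      0 < (A none).coeff n ∧ 0 < (A none).coeff (n + 1) := by
  classical
  obtain ⟨s, hs⟩ := Zring.exists_finset_span hlam hsum hI
  obtain ⟨n₁, hn₁, hn₁I⟩ := Zring.exists_pow_sub_one_mem hlam hsum hI
  obtain ⟨n₀, h₀⟩ := exists_pow_mul_aeval_add_aeval_eq_one hp1 hp0 hlam hsum hgcd
    (1 + ∑ A : s, A.1 + (1 + X))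
  set n := n₁ * (n₀ + m₀) with hn
  have hle : n₀ + m₀ ≤ n := Nat.le_mul_of_pos_left _ hn₁
  obtain ⟨R, hR⟩ := h₀ n (by omega)
  set P : ℕ[X] := ∑ i, X ^ lam i with hP
  have hPp : aeval p P = 1 := by rw [hP, map_sum]; simpa using hsum
  have hPdvd : X ^ m₀ ∣ P ^ m₀ := by
    refine pow_dvd_pow_of_dvd (Finset.dvd_sum fun i _ => dvd_pow_self _ (hlam i).ne') _
  set A : Option s → ℕ[X] := fun c => c.elim (X ^ n * (1 + X) + R * P ^ m₀)
    (fun B => X ^ n * B.1) with hA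
  have htot : p ^ n + ∑ c, aeval p (A c) = 1 := by
    rw [Fintype.sum_option]
    simp only [hA, Option.elim, map_add, map_mul, map_pow, aeval_X, map_one, hPp, one_pow, mul_one]
    simp only [map_add, map_sum, map_one, aeval_X] at hR
    rw [← Finset.mul_sum]
    linear_combination hR
  have hnI : Zring.gen p ^ n - 1 ∈ I := by
    have := sub_dvd_pow_sub_pow (Zring.gen p ^ n₁) 1 (n₀ + m₀)
    rw [one_pow, ← pow_mul] at this
    exact I.mem_of_dvd this hn₁I
  have hcoe : ∀ B : ℕ[X], Zring.ofNatPoly p (X ^ n * B) = Zring.gen p ^ n * Zring.ofNatPoly p B := by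
    intro B
    apply Subtype.ext
    simp [Zring.ofNatPoly, Zring.gen]
  refine ⟨n, s, A, by omega, htot, ?_, ?_, ?_, ?_⟩
  · intro c j hj
    refine X_pow_dvd_iff.1 ?_ j hj
    rcases c with _ | B
    · exact dvd_add ((pow_dvd_pow X (by omega)).mul_right _) (hPdvd.mul_left _)
    · exact (pow_dvd_pow X (by omega)).mul_right _
  · have hsome : ∀ B : s, Zring.ofNatPoly p (A (some B)) ∈ I := by
      intro B
      rw [hA]
      simp only [Option.elim]
      rw [hcoe]
      refine I.mul_mem_left _ ?_
      rw [← hs]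
      exact Ideal.subset_span ⟨B, B.2, rfl⟩
    refine le_antisymm (Ideal.span_le.2 ?_) ?_
    · rintro _ ⟨c, rfl⟩
      rcases c with _ | B
      · have e : Zring.ofNatPoly p (A none) =
            -(Zring.gen p ^ n - 1) - ∑ B : s, Zring.ofNatPoly p (A (some B)) := by
          apply Subtype.ext
          have : p ^ n + (aeval p (A none) + ∑ B : s, aeval p (A (some B))) = 1 := by
            rw [← htot, Fintype.sum_option]
          push_cast
          simp only [Zring.ofNatPoly, Zring.gen]
          linear_combination this
        change Zring.ofNatPoly p (A none) ∈ I
        rw [e]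
        exact I.sub_mem (I.neg_mem hnI) (I.sum_mem fun B _ => hsome B)
      · exact hsome B
    · obtain ⟨y, hxy, -⟩ := Zring.exists_inverse hlam hsum
      conv_lhs => rw [← hs]
      refine Ideal.span_le.2 ?_
      rintro _ ⟨B, hB, rfl⟩
      have e : Zring.ofNatPoly p B = y ^ n * Zring.ofNatPoly p (A (some ⟨B, hB⟩)) := by
        simp only [hA, Option.elim]
        rw [hcoe, ← mul_assoc, ← mul_pow, mul_comm y, hxy, one_pow, one_mul]
      rw [e]
      exact Ideal.mul_mem_left _ _ (Ideal.subset_span ⟨_, rfl⟩)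
  · have : (X ^ n * (1 + X) : ℕ[X]).coeff n = 1 := by
      have := coeff_X_pow_mul (1 + X : ℕ[X]) n 0
      simpa [coeff_one] using this
    simp only [hA, Option.elim, coeff_add, this]
    omega
  · have : (X ^ n * (1 + X) : ℕ[X]).coeff (n + 1) = 1 := by
      have := coeff_X_pow_mul (1 + X : ℕ[X]) n 1
      rw [add_comm n 1, this]
      simp [coeff_one]
    simp only [hA, Option.elim, coeff_add, this]
    omega

/-- A representation of `1` as a sum of powers of `p` with large exponents, one of them
distinguished and the others grouped into clusters whose sums generate a given ideal. -/
lemma Zring.exists_clusters (hp0 : 0 < p) (hp1 : p < 1) (hlam : ∀ i, 0 < lam i)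
    (hsum : ∑ i, p ^ lam i = 1) (hgcd : Finset.univ.gcd lam = 1)
    {I : Ideal (Zring p)} (hI : I ≠ ⊥) (m₀ : ℕ) :
    ∃ (n : ℕ) (α κ' : Type) (_ : Fintype α) (_ : Fintype κ') (_ : DecidableEq κ')
      (e : α → ℕ) (k : α → κ'),
      m₀ ≤ n ∧ (∀ i, m₀ ≤ e i) ∧ p ^ n + ∑ i, p ^ e i = 1 ∧
      (∃ i j, i ≠ j ∧ k i = k j ∧ e i = n ∧ e j = n + 1) ∧
      Ideal.span (Set.range fun c => ∑ i with k i = c, Zring.gen p ^ e i) = I := by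
  classical
  obtain ⟨n, s, A, hn, htot, hmin, hspan, h₁, h₂⟩ :=
    Zring.exists_polynomials hp0 hp1 hlam hsum hgcd hI m₀
  let e : Fin s.card ≃ s := s.equivFin.symm
  let κ' := Option (Fin s.card)
  let B : κ' → ℕ[X] := fun c => A (c.map e)
  let α := Σ c : κ', Σ m : Fin ((B c).natDegree + 1), Fin ((B c).coeff m)
  have hBsum : ∀ c, ∑ x : (Σ m : Fin ((B c).natDegree + 1), Fin ((B c).coeff m)),
      p ^ (x.1 : ℕ) = aeval p (B c) := by
    intro c
    rw [aeval_eq_sum_range, Finset.sum_range, Fintype.sum_sigma]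
    simp
  have hlt : ∀ c m, 0 < (B c).coeff m → m < (B c).natDegree + 1 := fun c m h =>
    Nat.lt_succ_of_le (le_natDegree_of_ne_zero h.ne')
  refine ⟨n, α, κ', inferInstance, inferInstance, inferInstance, fun x => x.2.1, fun x => x.1,
    hn, ?_, ?_, ?_, ?_⟩
  · rintro ⟨c, m, l⟩
    by_contra! hcon
    have : (B c).coeff m = 0 := hmin _ _ hcon
    exact absurd l.2 (by omega)
  · rw [Fintype.sum_sigma]
    simp only [hBsum]
    rw [← htot]
    congr 1
    exact Equiv.sum_comp (Equiv.optionCongr e) fun c => aeval p (A c)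
  · refine ⟨⟨none, ⟨n, hlt none n h₁⟩, ⟨0, h₁⟩⟩, ⟨none, ⟨n + 1, hlt none _ h₂⟩, ⟨0, h₂⟩⟩,
      ?_, rfl, rfl, rfl⟩
    intro h
    have := congrArg (fun x : α => (x.2.1 : ℕ)) h
    simp at this
  · rw [← hspan]
    congr 1
    have : ∀ c, ∑ x : α with x.1 = c, Zring.gen p ^ (x.2.1 : ℕ) = Zring.ofNatPoly p (B c) := by
      intro c
      apply Subtype.ext
      push_cast
      simp only [Zring.ofNatPoly, Zring.gen]
      rw [← hBsum c, Finset.sum_filter, Fintype.sum_sigma, Finset.sum_eq_single c]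
      · simp
      · intro b _ hb
        simp [hb]
      · simp
    simp only [this]
    exact (Equiv.optionCongr e).surjective.range_comp fun c => Zring.ofNatPoly p (A c)

end Arithmetic

/-! ### Hausdorff measure of self-similar sets under the open set condition -/

namespace IFS

open scoped NNReal ENNReal

variable {d : ℕ} (S : IFS d) {E O : Set (EuclideanSpace ℝ (Fin d))} {s : ℝ}

/-- The contraction ratio of a map of `S` as a nonnegative real. -/
def ratio (i : S.ι) : ℝ≥0 := ⟨S.r i, (S.r_pos i).le⟩

lemma ratio_ne_zero (i : S.ι) : S.ratio i ≠ 0 := fun h =>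
  (S.r_pos i).ne' (congrArg NNReal.toReal h)

lemma lipschitzWith (i : S.ι) : LipschitzWith (S.ratio i) (S.f i) :=
  LipschitzWith.of_dist_le_mul fun x y => (S.sim i x y).le

lemma antilipschitzWith (i : S.ι) : AntilipschitzWith (S.ratio i)⁻¹ (S.f i) :=
  AntilipschitzWith.of_le_mul_dist fun x y => by
    rw [S.sim i x y, NNReal.coe_inv]
    exact (inv_mul_cancel_left₀ (S.r_pos i).ne' _).ge

lemma injective (i : S.ι) : Function.Injective (S.f i) := (S.antilipschitzWith i).injective

lemma hausdorffMeasure_image {t : ℝ} (ht : 0 ≤ t) (i : S.ι)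
    (A : Set (EuclideanSpace ℝ (Fin d))) :
    μH[t] (S.f i '' A) = (S.ratio i : ℝ≥0∞) ^ t * μH[t] A := by
  refine le_antisymm ((S.lipschitzWith i).hausdorffMeasure_image_le ht A) ?_
  have h := (S.antilipschitzWith i).le_hausdorffMeasure_image ht A
  have h0 : (S.ratio i : ℝ≥0∞) ≠ 0 := by exact_mod_cast S.ratio_ne_zero i
  rw [ENNReal.coe_inv (S.ratio_ne_zero i), ENNReal.inv_rpow] at h
  have h1 : (S.ratio i : ℝ≥0∞) ^ t ≠ 0 := by
    simp [ENNReal.rpow_eq_zero_iff, h0]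
  have h2 : (S.ratio i : ℝ≥0∞) ^ t ≠ ⊤ := ENNReal.rpow_ne_top_of_nonneg ht ENNReal.coe_ne_top
  calc _ ≤ (S.ratio i : ℝ≥0∞) ^ t * (((S.ratio i : ℝ≥0∞) ^ t)⁻¹ * μH[t] (S.f i '' A)) := by gcongr
    _ = _ := ENNReal.mul_inv_cancel_left h1 h2

lemma ratio_rpow (hs : 0 ≤ s) (i : S.ι) :
    (S.ratio i : ℝ≥0∞) ^ s = ENNReal.ofReal (S.r i ^ s) := by
  rw [← ENNReal.ofReal_rpow_of_nonneg (S.r_pos i).le hs]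
  congr 1
  exact (ENNReal.ofReal_coe_nnreal (p := S.ratio i)).symm

lemma sum_ratio_rpow (hs : 0 ≤ s) (hsum : ∑ i, S.r i ^ s = 1) :
    ∑ i, (S.ratio i : ℝ≥0∞) ^ s = 1 := by
  simp only [S.ratio_rpow hs]
  rw [← ENNReal.ofReal_sum_of_nonneg fun i _ => Real.rpow_nonneg (S.r_pos i).le s, hsum,
    ENNReal.ofReal_one]

lemma isAttractor_attractor (h : ∃ E, S.IsAttractor E) : S.IsAttractor S.attractor := by
  rw [attractor, dif_pos h]
  exact h.choose_spec

lemma isAttractor_of_nonempty (h : S.attractor.Nonempty) : S.IsAttractor S.attractor := by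
  refine S.isAttractor_attractor ?_
  by_contra hcon
  rw [attractor, dif_neg hcon] at h
  exact Set.not_nonempty_empty h

variable {S}

lemma IsAttractor.mem (hE : S.IsAttractor E) {i : S.ι} {x : EuclideanSpace ℝ (Fin d)}
    (hx : x ∈ E) : S.f i x ∈ E := by
  rw [hE.2.2]
  exact mem_iUnion.2 ⟨i, x, hx, rfl⟩

lemma IsAttractor.exists_eq (hE : S.IsAttractor E) {x : EuclideanSpace ℝ (Fin d)}
    (hx : x ∈ E) : ∃ i, ∃ y ∈ E, S.f i y = x := by
  rw [hE.2.2] at hx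
  exact mem_iUnion.1 hx

lemma IsAttractor.nonempty (hE : S.IsAttractor E) : Nonempty S.ι := by
  obtain ⟨x, hx⟩ := hE.1
  exact ⟨(hE.exists_eq hx).choose⟩

/-- A common bound, less than one, for the contraction ratios. -/
lemma exists_ratio_bound (S : IFS d) [Nonempty S.ι] : ∃ ρ, 0 < ρ ∧ ρ < 1 ∧ ∀ i, S.r i ≤ ρ := by
  obtain ⟨i, hi⟩ := Finite.exists_max S.r
  exact ⟨S.r i, S.r_pos i, S.r_lt_one i, hi⟩

lemma IsAttractor.exists_cover (hE : S.IsAttractor E) (hs : 0 ≤ s)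
    (hsum : ∑ i, S.r i ^ s = 1) {ρ : ℝ≥0} (hρ : ∀ i, S.ratio i ≤ ρ) (n : ℕ) :
    ∃ (κ : Type) (_ : Fintype κ) (t : κ → Set (EuclideanSpace ℝ (Fin d))),
      E ⊆ ⋃ i, t i ∧ (∀ i, ediam (t i) ≤ (ρ : ℝ≥0∞) ^ n * ediam E) ∧
      ∑ i, ediam (t i) ^ s ≤ ediam E ^ s := by
  induction n with
  | zero => exact ⟨Unit, inferInstance, fun _ => E, subset_iUnion (fun _ : Unit => E) (),
      by simp, by simp⟩
  | succ n ih =>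
    obtain ⟨κ, _, t, h₁, h₂, h₃⟩ := ih
    refine ⟨S.ι × κ, inferInstance, fun x => S.f x.1 '' t x.2, ?_, ?_, ?_⟩
    · intro x hx
      obtain ⟨i, y, hy, rfl⟩ := hE.exists_eq hx
      obtain ⟨j, hj⟩ := mem_iUnion.1 (h₁ hy)
      exact mem_iUnion.2 ⟨(i, j), y, hj, rfl⟩
    · rintro ⟨i, j⟩
      calc ediam (S.f i '' t j) ≤ S.ratio i * ediam (t j) := (S.lipschitzWith i).ediam_image_le _
        _ ≤ ρ * ((ρ : ℝ≥0∞) ^ n * ediam E) := by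
          gcongr
          · exact hρ i
          · exact h₂ j
        _ = _ := by rw [pow_succ', mul_assoc]
    · calc ∑ x : S.ι × κ, ediam (S.f x.1 '' t x.2) ^ s
          ≤ ∑ x : S.ι × κ, (S.ratio x.1 : ℝ≥0∞) ^ s * ediam (t x.2) ^ s := by
            refine Finset.sum_le_sum fun x _ => ?_
            rw [← ENNReal.mul_rpow_of_nonneg _ _ hs]
            exact ENNReal.rpow_le_rpow ((S.lipschitzWith _).ediam_image_le _) hs
        _ = (∑ i, (S.ratio i : ℝ≥0∞) ^ s) * ∑ j, ediam (t j) ^ s := by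
            rw [Fintype.sum_prod_type, Finset.sum_mul_sum]
        _ ≤ _ := by rw [S.sum_ratio_rpow hs hsum, one_mul]; exact h₃

lemma IsAttractor.hausdorffMeasure_ne_top (hE : S.IsAttractor E) (hs : 0 ≤ s)
    (hsum : ∑ i, S.r i ^ s = 1) : μH[s] E ≠ ⊤ := by
  have := hE.nonempty
  obtain ⟨ρ, hρ0, hρ1, hρ⟩ := S.exists_ratio_bound
  lift ρ to ℝ≥0 using hρ0.le
  have hD : ediam E ≠ ⊤ := hE.2.1.isBounded.ediam_ne_top
  choose κ hκ t h₁ h₂ h₃ using hE.exists_cover hs hsum (ρ := ρ) hρ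
  have hlim : Filter.Tendsto (fun n : ℕ => (ρ : ℝ≥0∞) ^ n * ediam E) Filter.atTop (nhds 0) := by
    have := ENNReal.tendsto_pow_atTop_nhds_zero_of_lt_one (r := ρ) (by exact_mod_cast hρ1)
    simpa using ENNReal.Tendsto.mul_const this (Or.inr hD)
  have := Measure.hausdorffMeasure_le_liminf_sum s E _ hlim t
    (Filter.Eventually.of_forall h₂) (Filter.Eventually.of_forall h₁)
  refine ne_top_of_le_ne_top (ENNReal.rpow_ne_top_of_nonneg hs hD) (this.trans ?_)
  calc _ ≤ Filter.liminf (fun _ : ℕ => ediam E ^ s) Filter.atTop :=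
        Filter.liminf_le_liminf (Filter.Eventually.of_forall h₃)
    _ = _ := Filter.liminf_const _

open scoped Classical in
/-- The total weight of the cylinders of generation `n` that meet a given set. -/
def mass (S : IFS d) (E : Set (EuclideanSpace ℝ (Fin d))) (s : ℝ) :
    ℕ → Set (EuclideanSpace ℝ (Fin d)) → ℝ
  | 0, U => if (E ∩ U).Nonempty then 1 else 0
  | n + 1, U => ∑ i, S.r i ^ s * mass S E s n (S.f i ⁻¹' U)

lemma mass_nonneg (n : ℕ) (U : Set (EuclideanSpace ℝ (Fin d))) : 0 ≤ S.mass E s n U := by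
  induction n generalizing U with
  | zero => rw [mass]; split_ifs <;> norm_num
  | succ n ih =>
    exact Finset.sum_nonneg fun i _ => mul_nonneg (Real.rpow_nonneg (S.r_pos i).le s) (ih _)

lemma mass_le_one (hsum : ∑ i, S.r i ^ s = 1) (n : ℕ) (U : Set (EuclideanSpace ℝ (Fin d))) :
    S.mass E s n U ≤ 1 := by
  induction n generalizing U with
  | zero => rw [mass]; split_ifs <;> norm_num
  | succ n ih =>
    rw [← hsum]
    exact Finset.sum_le_sum fun i _ =>
      mul_le_of_le_one_right (Real.rpow_nonneg (S.r_pos i).le s) (ih _)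

lemma mass_biUnion_le {κ : Type*} (T : Finset κ) (U : κ → Set (EuclideanSpace ℝ (Fin d)))
    (n : ℕ) : S.mass E s n (⋃ j ∈ T, U j) ≤ ∑ j ∈ T, S.mass E s n (U j) := by
  induction n generalizing U with
  | zero =>
    by_cases h : (E ∩ ⋃ j ∈ T, U j).Nonempty
    · obtain ⟨x, hx, hxU⟩ := h
      simp only [mem_iUnion, exists_prop] at hxU
      obtain ⟨j, hj, hxj⟩ := hxU
      have h1 : S.mass E s 0 (U j) = 1 := if_pos ⟨x, hx, hxj⟩
      have h2 := Finset.single_le_sum (f := fun j => S.mass E s 0 (U j))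
        (fun j _ => mass_nonneg 0 (U j)) hj
      refine le_trans ?_ (h1.ge.trans h2)
      rw [mass]
      split_ifs <;> norm_num
    · rw [mass, if_neg h]
      exact Finset.sum_nonneg fun j _ => mass_nonneg 0 (U j)
  | succ n ih =>
    simp only [mass, preimage_iUnion]
    rw [Finset.sum_comm]
    refine Finset.sum_le_sum fun i _ => ?_
    rw [← Finset.mul_sum]
    exact mul_le_mul_of_nonneg_left (ih _) (Real.rpow_nonneg (S.r_pos i).le s)

lemma IsAttractor.mass_eq_one (hE : S.IsAttractor E) (hsum : ∑ i, S.r i ^ s = 1) (n : ℕ)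
    {U : Set (EuclideanSpace ℝ (Fin d))} (hU : E ⊆ U) : S.mass E s n U = 1 := by
  induction n generalizing U with
  | zero => exact if_pos (by rw [inter_eq_left.2 hU]; exact hE.1)
  | succ n ih =>
    rw [mass, ← hsum]
    refine Finset.sum_congr rfl fun i _ => ?_
    rw [ih (U := S.f i ⁻¹' U) fun x hx => hU (hE.mem hx), mul_one]

lemma IsAttractor.mass_eq_zero (hE : S.IsAttractor E) (n : ℕ)
    {U : Set (EuclideanSpace ℝ (Fin d))} (hU : ¬ (E ∩ U).Nonempty) : S.mass E s n U = 0 := by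
  induction n generalizing U with
  | zero => exact if_neg hU
  | succ n ih =>
    refine Finset.sum_eq_zero fun i _ => ?_
    rw [ih, mul_zero]
    rintro ⟨x, hx, hxU⟩
    exact hU ⟨_, hE.mem hx, hxU⟩

/-- Lebesgue measure, normalised as a Hausdorff measure. -/
abbrev vol (d : ℕ) : Measure (EuclideanSpace ℝ (Fin d)) :=
  μH[(Module.finrank ℝ (EuclideanSpace ℝ (Fin d)) : ℝ)]

lemma vol_real_image (S : IFS d) (i : S.ι) (A : Set (EuclideanSpace ℝ (Fin d))) :
    (vol d).real (S.f i '' A) = S.r i ^ d * (vol d).real A := by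
  rw [Measure.real, Measure.real, S.hausdorffMeasure_image (Nat.cast_nonneg _),
    ENNReal.toReal_mul, ENNReal.rpow_natCast, ENNReal.toReal_pow, ENNReal.coe_toReal]
  congr 1
  rw [finrank_euclideanSpace_fin]
  rfl

lemma OSCSet.sum_vol_le (hO : S.OSCSet O) (U : Set (EuclideanSpace ℝ (Fin d)))
    (hU : MeasurableSet U) :
    ∑ i, (vol d).real (S.f i '' O ∩ U) ≤ (vol d).real (O ∩ U) := by
  obtain ⟨-, hop, hbd, hsub, hdis⟩ := hO
  have hfin : (vol d) (O ∩ U) ≠ ⊤ :=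
    (measure_mono inter_subset_left).trans_lt hbd.measure_lt_top |>.ne
  have h1 : Pairwise (Function.onFun Disjoint fun i => S.f i '' O ∩ U) :=
    fun i j hij => (hdis i j hij).mono inter_subset_left inter_subset_left
  have h2 : ∀ i, MeasurableSet (S.f i '' O ∩ U) := fun i =>
    (hop.measurableSet.image_of_continuousOn_injOn
      (S.lipschitzWith i).continuous.continuousOn (S.injective i).injOn).inter hU
  have h3 : ∀ i, (vol d) (S.f i '' O ∩ U) ≠ ⊤ := fun i =>
    ne_top_of_le_ne_top hfin (measure_mono (inter_subset_inter_left _ (hsub i)))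
  rw [← measureReal_iUnion_fintype h1 h2 h3]
  exact measureReal_mono (iUnion_subset fun i => inter_subset_inter_left _ (hsub i)) hfin

/-- The volume estimate behind the mass distribution principle. -/
lemma IsAttractor.mass_le_vol (hE : S.IsAttractor E) (hO : S.OSCSet O) (hs : 0 ≤ s)
    (hsum : ∑ i, S.r i ^ s = 1) {K M ρ₀ : ℝ} (hK : ∀ x ∈ E, ∀ y ∈ O, dist y x < K)
    (hM : ∀ i, 1 ≤ M * S.r i) (hρ₀0 : 0 < ρ₀) (hρ₀ : ∀ i, S.r i ≤ ρ₀) (n : ℕ) {ρ : ℝ}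
    (hρ : ρ₀ ^ n ≤ ρ) (hρM : ρ ≤ M) (U : Set (EuclideanSpace ℝ (Fin d))) :
    S.mass E s n U ≤ M ^ d / (vol d).real O * (ρ ^ s / ρ ^ d) *
      (vol d).real (O ∩ thickening (K * ρ) U) := by
  have hVO : 0 < (vol d).real O := by
    rw [Measure.real, ENNReal.toReal_pos_iff]
    exact ⟨hO.2.1.measure_pos _ hO.1, hO.2.2.1.measure_lt_top⟩
  have hKpos : 0 < K := by
    obtain ⟨x, hx⟩ := hE.1
    obtain ⟨y, hy⟩ := hO.1
    exact dist_nonneg.trans_lt (hK x hx y hy)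
  have hlarge : ∀ (n : ℕ) (ρ : ℝ) (U : Set (EuclideanSpace ℝ (Fin d))), 1 ≤ ρ → ρ ≤ M →
      S.mass E s n U ≤ M ^ d / (vol d).real O * (ρ ^ s / ρ ^ d) *
        (vol d).real (O ∩ thickening (K * ρ) U) := by
    intro n ρ U hρ1 hρM
    have hρ0 : 0 < ρ := by linarith
    have hM0 : 0 < M := by linarith
    by_cases hEU : (E ∩ U).Nonempty
    · refine (mass_le_one hsum n U).trans ?_
      obtain ⟨x, hxE, hxU⟩ := hEU
      have : O ∩ thickening (K * ρ) U = O := by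
        refine inter_eq_left.2 fun y hy => mem_thickening_iff.2 ⟨x, hxU, ?_⟩
        exact (hK x hxE y hy).trans_le (le_mul_of_one_le_right hKpos.le hρ1)
      rw [this]
      have e : M ^ d / (vol d).real O * (ρ ^ s / ρ ^ d) * (vol d).real O =
          (M / ρ) ^ d * ρ ^ s := by
        rw [div_pow]
        field_simp
      rw [e]
      exact one_le_mul_of_one_le_of_one_le (one_le_pow₀ ((one_le_div hρ0).2 hρM))
        (Real.one_le_rpow hρ1 hs)
    · rw [hE.mass_eq_zero n hEU]
      positivity
  induction n generalizing ρ U with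
  | zero => exact hlarge 0 ρ U (by simpa using hρ) hρM
  | succ n ih =>
    rcases le_or_gt 1 ρ with h1 | h1
    · exact hlarge _ ρ U h1 hρM
    have hρ0 : 0 < ρ := (pow_pos hρ₀0 _).trans_le hρ
    have hM0 : 0 < M := by linarith
    rw [mass]
    calc ∑ i, S.r i ^ s * S.mass E s n (S.f i ⁻¹' U)
        ≤ ∑ i, M ^ d / (vol d).real O * (ρ ^ s / ρ ^ d) *
            (vol d).real (S.f i '' O ∩ thickening (K * ρ) U) := by
          refine Finset.sum_le_sum fun i _ => ?_
          have hr := S.r_pos i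
          have h2 : ρ₀ ^ n ≤ ρ / S.r i := by
            rw [le_div_iff₀ hr]
            refine le_trans ?_ hρ
            rw [pow_succ]
            exact mul_le_mul_of_nonneg_left (hρ₀ i) (by positivity)
          have h3 : ρ / S.r i ≤ M := by
            rw [div_le_iff₀ hr]
            linarith [hM i]
          refine (mul_le_mul_of_nonneg_left (ih h2 h3 _) (Real.rpow_nonneg hr.le s)).trans ?_
          have h4 : S.r i ^ d * (vol d).real (O ∩ thickening (K * (ρ / S.r i)) (S.f i ⁻¹' U)) ≤
              (vol d).real (S.f i '' O ∩ thickening (K * ρ) U) := by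
            rw [← vol_real_image]
            refine measureReal_mono ?_
              (ne_top_of_le_ne_top hO.2.2.1.measure_lt_top.ne
                (measure_mono (inter_subset_left.trans (hO.2.2.2.1 i))))
            rintro _ ⟨x, ⟨hxO, hxt⟩, rfl⟩
            refine ⟨⟨x, hxO, rfl⟩, ?_⟩
            obtain ⟨z, hz, hxz⟩ := mem_thickening_iff.1 hxt
            refine mem_thickening_iff.2 ⟨_, hz, ?_⟩
            rw [S.sim]
            calc S.r i * dist x z < S.r i * (K * (ρ / S.r i)) := by gcongr
              _ = K * ρ := by field_simp
          calc _ = M ^ d / (vol d).real O * (ρ ^ s / ρ ^ d) * (S.r i ^ d *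
                (vol d).real (O ∩ thickening (K * (ρ / S.r i)) (S.f i ⁻¹' U))) := by
                have : S.r i ^ s ≠ 0 := (Real.rpow_pos_of_pos hr s).ne'
                rw [Real.div_rpow hρ0.le hr.le, div_pow]
                field_simp
            _ ≤ _ := by gcongr
      _ = M ^ d / (vol d).real O * (ρ ^ s / ρ ^ d) *
            ∑ i, (vol d).real (S.f i '' O ∩ thickening (K * ρ) U) := by rw [Finset.mul_sum]
      _ ≤ _ := by
          gcongr
          exact hO.sum_vol_le _ isOpen_thickening.measurableSet

lemma IsAttractor.exists_mass_le (hE : S.IsAttractor E) (hO : S.OSCSet O) (hs : 0 ≤ s)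
    (hsum : ∑ i, S.r i ^ s = 1) : ∃ C ρ₀ : ℝ, 0 < C ∧ ρ₀ < 1 ∧ 0 < ρ₀ ∧
      ∀ (n : ℕ) (ρ : ℝ) (U : Set (EuclideanSpace ℝ (Fin d))), ρ₀ ^ n ≤ ρ → ρ ≤ 1 →
        (∀ x ∈ U, ∀ y ∈ U, dist x y ≤ ρ) → S.mass E s n U ≤ C * ρ ^ s := by
  have := hE.nonempty
  obtain ⟨ρ₀, hρ₀0, hρ₀1, hρ₀⟩ := S.exists_ratio_bound
  obtain ⟨i₀, hi₀⟩ := Finite.exists_min S.r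
  set M := (S.r i₀)⁻¹
  have hM1 : 1 ≤ M := (one_le_inv₀ (S.r_pos i₀)).2 (S.r_lt_one i₀).le
  have hM : ∀ i, 1 ≤ M * S.r i := fun i => by
    rw [← inv_mul_cancel₀ (S.r_pos i₀).ne']
    gcongr
    exact hi₀ i
  obtain ⟨K, hK⟩ := isBounded_iff.1 (hE.2.1.isBounded.union hO.2.2.1)
  have hK' : ∀ x ∈ E, ∀ y ∈ O, dist y x < K + 1 := fun x hx y hy =>
    (hK (Or.inr hy) (Or.inl hx)).trans_lt (lt_add_one K)
  have hK0 : 0 ≤ K := by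
    obtain ⟨x, hx⟩ := hE.1
    exact dist_nonneg.trans (hK (Or.inl hx) (Or.inl hx))
  have hVO : 0 < (vol d).real O := by
    rw [Measure.real, ENNReal.toReal_pos_iff]
    exact ⟨hO.2.1.measure_pos _ hO.1, hO.2.2.1.measure_lt_top⟩
  set B := (vol d).real (ball 0 1)
  have hB : 0 < B :=
    ENNReal.toReal_pos_iff.2 ⟨measure_ball_pos _ _ one_pos, measure_ball_lt_top⟩
  refine ⟨M ^ d / (vol d).real O * ((K + 2) ^ d * B), ρ₀, by positivity, hρ₀1, hρ₀0, ?_⟩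
  intro n ρ U hρ hρ1 hU
  have hρ0 : 0 < ρ := (pow_pos hρ₀0 _).trans_le hρ
  rcases U.eq_empty_or_nonempty with rfl | ⟨u, hu⟩
  · rw [hE.mass_eq_zero n (by simp)]
    positivity
  refine (hE.mass_le_vol hO hs hsum hK' hM hρ₀0 hρ₀ n hρ (hρ1.trans hM1) U).trans ?_
  have h1 : (vol d).real (O ∩ thickening ((K + 1) * ρ) U) ≤ ((K + 2) * ρ) ^ d * B := by
    have h2 : (vol d).real (ball u ((K + 2) * ρ)) = ((K + 2) * ρ) ^ d * B := by
      rw [Measure.real, Measure.addHaar_ball_of_pos _ _ (by positivity), ENNReal.toReal_mul,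
        ENNReal.toReal_ofReal (by positivity), finrank_euclideanSpace_fin]
      rfl
    rw [← h2]
    refine measureReal_mono ?_ measure_ball_lt_top.ne
    rintro x ⟨-, hx⟩
    obtain ⟨z, hz, hxz⟩ := mem_thickening_iff.1 hx
    rw [mem_ball]
    have := dist_triangle x z u
    have := hU z hz u hu
    linarith
  calc _ ≤ M ^ d / (vol d).real O * (ρ ^ s / ρ ^ d) * (((K + 2) * ρ) ^ d * B) := by gcongr
    _ = _ := by rw [mul_pow]; field_simp

lemma IsAttractor.hausdorffMeasure_ne_zero (hE : S.IsAttractor E) (hO : S.OSCSet O) (hs : 0 ≤ s)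
    (hsum : ∑ i, S.r i ^ s = 1) : μH[s] E ≠ 0 := by
  intro hzero
  obtain ⟨C, ρ₀, hC, hρ₀1, hρ₀0, hmass⟩ := hE.exists_mass_le hO hs hsum
  have hε : ENNReal.ofReal (C⁻¹ / 2) ≠ 0 := by
    rw [Ne, ENNReal.ofReal_eq_zero, not_le]; positivity
  obtain ⟨t, hEt, hdiam, hlt⟩ : ∃ t : ℕ → Set (EuclideanSpace ℝ (Fin d)), E ⊆ ⋃ n, t n ∧
      (∀ n, ediam (t n) ≤ ENNReal.ofReal (1 / 2)) ∧
      ∑' n, ⨆ (_ : (t n).Nonempty), ediam (t n) ^ s < ENNReal.ofReal (C⁻¹ / 2) := by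
    rw [Measure.hausdorffMeasure_apply] at hzero
    have h := (iSup₂_le_iff.1 hzero.le) (ENNReal.ofReal (1 / 2)) (by simp)
    have h := h.trans_lt (pos_iff_ne_zero.2 hε)
    simp only [iInf_lt_iff] at h
    obtain ⟨t, h₁, h₂, h₃⟩ := h
    exact ⟨t, h₁, h₂, h₃⟩
  obtain ⟨ε, hε0, hεsum⟩ := ENNReal.exists_pos_sum_of_countable hε ℕ
  have hfin : ∀ n, ediam (t n) ≠ ⊤ := fun n => ne_top_of_le_ne_top ENNReal.ofReal_ne_top (hdiam n)
  have hρ : ∀ n, ∃ ρ, (ediam (t n)).toReal < ρ ∧ ρ ≤ 1 ∧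
      ρ ^ s ≤ (ediam (t n)).toReal ^ s + ε n := by
    intro n
    have ha : (ediam (t n)).toReal < 1 :=
      (ENNReal.toReal_le_of_le_ofReal (by norm_num) (hdiam n)).trans_lt (by norm_num)
    have hc := (Real.continuousAt_rpow_const (ediam (t n)).toReal s (Or.inr hs)).eventually_lt
      (continuousAt_const (y := (ediam (t n)).toReal ^ s + ε n))
      (by simpa using hε0 n)
    have h2 : ∀ᶠ ρ in nhdsWithin (ediam (t n)).toReal (Ioi (ediam (t n)).toReal),
      (ediam (t n)).toReal < ρ ∧ ρ ≤ 1 ∧ ρ ^ s ≤ (ediam (t n)).toReal ^ s + ε n := by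
      filter_upwards [self_mem_nhdsWithin, nhdsWithin_le_nhds hc,
        nhdsWithin_le_nhds (Iio_mem_nhds ha)] with ρ h1 h2 h3
      exact ⟨h1, (mem_Iio.1 h3).le, h2.le⟩
    exact h2.exists
  choose ρ hρ1 hρ2 hρ3 using hρ
  set U : ℕ → Set (EuclideanSpace ℝ (Fin d)) := fun n =>
    thickening ((ρ n - (ediam (t n)).toReal) / 2) (t n) with hU
  have hUd : ∀ n, ∀ x ∈ U n, ∀ y ∈ U n, dist x y ≤ ρ n := by
    intro n x hx y hy
    obtain ⟨x', hx', hxx⟩ := mem_thickening_iff.1 hx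
    obtain ⟨y', hy', hyy⟩ := mem_thickening_iff.1 hy
    have h1 : dist x' y' ≤ (ediam (t n)).toReal := by
      rw [dist_edist]
      exact ENNReal.toReal_mono (hfin n) (edist_le_ediam_of_mem hx' hy')
    have h2 := dist_triangle4 x x' y' y
    rw [dist_comm y y'] at hyy
    linarith
  obtain ⟨T, hT⟩ := hE.2.1.elim_finite_subcover U (fun n => isOpen_thickening) (by
    refine hEt.trans (iUnion_mono fun n => self_subset_thickening ?_ _)
    linarith [hρ1 n])
  obtain ⟨n, hn⟩ : ∃ n : ℕ, ∀ j ∈ T, ρ₀ ^ n ≤ ρ j := by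
    have h : ∀ᶠ n : ℕ in Filter.atTop, ∀ j ∈ T, ρ₀ ^ n ≤ ρ j := by
      rw [Filter.eventually_all_finset]
      intro j _
      have hj : 0 < ρ j := ENNReal.toReal_nonneg.trans_lt (hρ1 j)
      exact ((tendsto_pow_atTop_nhds_zero_of_lt_one hρ₀0.le hρ₀1).eventually_lt_const hj).mono
        fun _ h => h.le
    exact h.exists
  have hterm : ∀ j ∈ T, ENNReal.ofReal (S.mass E s n (U j)) ≤
      ENNReal.ofReal C * ((⨆ (_ : (t j).Nonempty), ediam (t j) ^ s) + ε j) := by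
    intro j hj
    rcases (t j).eq_empty_or_nonempty with h0 | h0
    · have : U j = ∅ := by rw [hU]; simp [h0]
      rw [this, hE.mass_eq_zero n (by simp)]
      simp
    · rw [iSup_pos h0]
      refine (ENNReal.ofReal_le_ofReal (hmass n _ _ (hn j hj) (hρ2 j) (hUd j))).trans ?_
      rw [ENNReal.ofReal_mul hC.le]
      gcongr
      refine (ENNReal.ofReal_le_ofReal (hρ3 j)).trans ?_
      rw [ENNReal.ofReal_add (Real.rpow_nonneg ENNReal.toReal_nonneg s)
        (NNReal.coe_nonneg _),
        ← ENNReal.ofReal_rpow_of_nonneg ENNReal.toReal_nonneg hs, ENNReal.ofReal_toReal (hfin j),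
        ENNReal.ofReal_coe_nnreal]
  have h1 : (1 : ℝ) ≤ ∑ j ∈ T, S.mass E s n (U j) := by
    rw [← hE.mass_eq_one hsum n hT]
    exact mass_biUnion_le T U n
  have : (1 : ℝ≥0∞) < 1 := by
    calc (1 : ℝ≥0∞) = ENNReal.ofReal 1 := ENNReal.ofReal_one.symm
      _ ≤ ENNReal.ofReal (∑ j ∈ T, S.mass E s n (U j)) := ENNReal.ofReal_le_ofReal h1
      _ = ∑ j ∈ T, ENNReal.ofReal (S.mass E s n (U j)) :=
        ENNReal.ofReal_sum_of_nonneg fun j _ => mass_nonneg _ _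
      _ ≤ ∑ j ∈ T, ENNReal.ofReal C * ((⨆ (_ : (t j).Nonempty), ediam (t j) ^ s) + ε j) :=
        Finset.sum_le_sum hterm
      _ ≤ ∑' j, ENNReal.ofReal C * ((⨆ (_ : (t j).Nonempty), ediam (t j) ^ s) + ε j) :=
        ENNReal.sum_le_tsum T
      _ = ENNReal.ofReal C * (∑' j, (⨆ (_ : (t j).Nonempty), ediam (t j) ^ s) +
          ∑' j, (ε j : ℝ≥0∞)) := by rw [ENNReal.tsum_mul_left, ENNReal.tsum_add]
      _ < ENNReal.ofReal C * (ENNReal.ofReal (C⁻¹ / 2) + ENNReal.ofReal (C⁻¹ / 2)) := by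
        refine ENNReal.mul_lt_mul_right ?_ ENNReal.ofReal_ne_top (ENNReal.add_lt_add hlt hεsum)
        rw [Ne, ENNReal.ofReal_eq_zero, not_le]; exact hC
      _ = 1 := by
        rw [← ENNReal.ofReal_add (by positivity) (by positivity), ← ENNReal.ofReal_mul hC.le,
          add_halves, mul_inv_cancel₀ hC.ne', ENNReal.ofReal_one]
  exact lt_irrefl _ this

/-- The dimension formula of Moran and Hutchinson. -/
theorem IsAttractor.dimH_eq (hE : S.IsAttractor E) (hO : S.OSCSet O) (hs : 0 ≤ s)
    (hsum : ∑ i, S.r i ^ s = 1) : (dimH E).toReal = s := by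
  lift s to ℝ≥0 using hs
  rw [dimH_of_hausdorffMeasure_ne_zero_ne_top (hE.hausdorffMeasure_ne_zero hO s.2 hsum)
    (hE.hausdorffMeasure_ne_top s.2 hsum)]
  rfl

lemma exists_sum_rpow_eq_one (S : IFS d) [Nonempty S.ι] : ∃ s : ℝ, 0 ≤ s ∧
    ∑ i, S.r i ^ s = 1 := by
  obtain ⟨ρ, hρ0, hρ1, hρ⟩ := S.exists_ratio_bound
  set N := Fintype.card S.ι
  have hN : 0 < N := Fintype.card_pos
  obtain ⟨n, hn⟩ := exists_pow_lt_of_lt_one (show (0 : ℝ) < (N : ℝ)⁻¹ by positivity) hρ1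
  have hcont : Continuous fun s : ℝ => ∑ i, S.r i ^ s :=
    continuous_finsetSum _ fun i _ => Real.continuous_const_rpow (S.r_pos i).ne'
  have := intermediate_value_Icc' (Nat.cast_nonneg (α := ℝ) n) hcont.continuousOn
  obtain ⟨s, hs, h⟩ := this (show (1 : ℝ) ∈ _ by
    constructor
    · calc ∑ i, S.r i ^ (n : ℝ) ≤ ∑ i : S.ι, ρ ^ n := by
            refine Finset.sum_le_sum fun i _ => ?_
            rw [Real.rpow_natCast]
            exact pow_le_pow_left₀ (S.r_pos i).le (hρ i) n
        _ = N * ρ ^ n := by simp [N]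
        _ ≤ N * (N : ℝ)⁻¹ := by gcongr
        _ = 1 := mul_inv_cancel₀ (by positivity)
    · simp only [Real.rpow_zero, Finset.sum_const, Finset.card_univ, nsmul_eq_mul, mul_one]
      exact_mod_cast hN)
  exact ⟨s, hs.1, h⟩

/-- The measure root of a member of `TOEC(p, r)` satisfies `∑ p ^ lam i = 1` with coprime
positive exponents. -/
lemma MemTOECpr.exists_exponents {p r : ℝ} (hp1 : p < 1) (h : S.MemTOECpr p r) :
    0 < S.hdim ∧ ∃ lam : S.ι → ℕ, (∀ i, 0 < lam i) ∧ ∑ i, p ^ lam i = 1 ∧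
      Finset.univ.gcd lam = 1 := by
  obtain ⟨⟨⟨O, hO⟩, -, -⟩, ⟨hr0, hr1, lam, hlam, hr, hgcd⟩, hp⟩ := h
  have hpos : S.hdim ≠ 0 := by
    intro h0
    rw [h0, Real.rpow_zero] at hp
    exact hp1.ne hp
  have hne : S.attractor.Nonempty := by
    rw [nonempty_iff_ne_empty]
    intro h0
    apply hpos
    rw [hdim, h0]
    simp
  have hE := S.isAttractor_of_nonempty hne
  have := hE.nonempty
  obtain ⟨s, hs, hsum⟩ := S.exists_sum_rpow_eq_one
  have hdim_eq : S.hdim = s := hE.dimH_eq hO hs hsum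
  refine ⟨(hdim_eq ▸ hs).lt_of_ne' hpos, lam, hlam, ?_, hgcd⟩
  rw [← hsum, hp, hdim_eq]
  refine Finset.sum_congr rfl fun i _ => ?_
  rw [hr i, ← Real.rpow_natCast, ← Real.rpow_natCast, ← Real.rpow_mul hr0.le,
    ← Real.rpow_mul hr0.le, mul_comm]

end IFS

/-! ### Systems whose pieces meet in clusters -/

/-- `F` is a relatively clopen part of the compact set `E`. -/
structure IsClopenPart {X : Type*} [TopologicalSpace X] (E F : Set X) : Prop where
  subset : F ⊆ E
  closed : IsClosed F
  closed_diff : IsClosed (E \ F)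

namespace IsClopenPart

variable {X : Type*} [TopologicalSpace X] {E F : Set X}

lemma diff (h : IsClopenPart E F) : IsClopenPart E (E \ F) :=
  ⟨sdiff_subset, h.closed_diff, by rw [sdiff_sdiff_cancel_left h.subset]; exact h.closed⟩

lemma self (h : IsClosed E) : IsClopenPart E E := ⟨Subset.rfl, h, by simp⟩

lemma preimage (hE : IsClosed E) (h : IsClopenPart E F) {g : X → X} (hg : Continuous g)
    (hgE : MapsTo g E E) : IsClopenPart E (E ∩ g ⁻¹' F) := by
  refine ⟨inter_subset_left, hE.inter (h.closed.preimage hg), ?_⟩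
  have : E \ (E ∩ g ⁻¹' F) = E ∩ g ⁻¹' (E \ F) := by
    ext x
    simp only [mem_sdiff, mem_inter_iff, mem_preimage]
    exact ⟨fun hx => ⟨hx.1, hgE hx.1, fun h => hx.2 ⟨hx.1, h⟩⟩, fun hx => ⟨hx.1, fun h => hx.2.2 h.2⟩⟩
  rw [this]
  exact hE.inter (h.closed_diff.preimage hg)

end IsClopenPart

lemma isTotallyDisconnected_of_separated {X : Type*} [TopologicalSpace X] {E : Set X}
    (h : ∀ x ∈ E, ∀ y ∈ E, x ≠ y → ∃ F, IsClopenPart E F ∧ x ∈ F ∧ y ∉ F) :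
    IsTotallyDisconnected E := by
  intro t htE ht x hx y hy
  by_contra hxy
  obtain ⟨F, hF, hxF, hyF⟩ := h x (htE hx) y (htE hy) hxy
  obtain ⟨w, -, hw1, hw2⟩ := isPreconnected_closed_iff.1 ht F (E \ F) hF.closed hF.closed_diff
    (fun z hz => (em (z ∈ F)).imp_right fun hzF => ⟨htE hz, hzF⟩) ⟨x, hx, hxF⟩ ⟨y, hy, htE hy, hyF⟩
  exact hw2.2 hw1

namespace IFS

open scoped NNReal ENNReal

variable {d : ℕ} {S : IFS d} {κ : Type} {i₀ : S.ι} {k : S.ι → κ}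

/-- The first-level pieces of the attractor are grouped by `k` into clusters. Different clusters
are disjoint, the pieces of one cluster share exactly one point, the image of the origin, and the
map `i₀`, which fixes the origin, forms a cluster of its own. -/
structure Clustered (S : IFS d) (i₀ : S.ι) (k : S.ι → κ) : Prop where
  att : S.IsAttractor S.attractor
  map_zero : S.f i₀ 0 = 0
  eq_of_cluster : ∀ i, k i = k i₀ → i = i₀
  cluster_eq : ∀ i j, ∀ x ∈ S.attractor, ∀ y ∈ S.attractor, S.f i x = S.f j y → k i = k j
  vertex : ∀ i j, k i = k j → S.f i 0 = S.f j 0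
  eq_zero : ∀ i j, i ≠ j → ∀ x ∈ S.attractor, ∀ y ∈ S.attractor, S.f i x = S.f j y → x = 0

namespace Clustered

lemma isClosed (h : S.Clustered i₀ k) : IsClosed S.attractor := h.att.2.1.isClosed

lemma isClosed_image (S : IFS d) (hS : IsCompact S.attractor) (i : S.ι)
    {F : Set (EuclideanSpace ℝ (Fin d))} (hF : IsClosed F) (hFS : F ⊆ S.attractor) :
    IsClosed (S.f i '' F) :=
  ((hS.of_isClosed_subset hF hFS).image (S.lipschitzWith i).continuous).isClosed

lemma dist_iterate (S : IFS d) (i : S.ι) (n : ℕ) (x y : EuclideanSpace ℝ (Fin d)) :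
    dist ((S.f i)^[n] x) ((S.f i)^[n] y) = S.r i ^ n * dist x y := by
  induction n with
  | zero => simp
  | succ n ih => rw [Function.iterate_succ_apply', Function.iterate_succ_apply', S.sim, ih]; ring

lemma iterate_zero (h : S.Clustered i₀ k) (n : ℕ) : (S.f i₀)^[n] 0 = 0 :=
  Function.iterate_fixed h.map_zero n

lemma zero_mem (h : S.Clustered i₀ k) : (0 : EuclideanSpace ℝ (Fin d)) ∈ S.attractor := by
  obtain ⟨x, hx⟩ := h.att.1
  have hmem : ∀ n : ℕ, (S.f i₀)^[n] x ∈ S.attractor := fun n => by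
    induction n with
    | zero => exact hx
    | succ n ih => rw [Function.iterate_succ_apply']; exact h.att.mem ih
  refine h.isClosed.mem_of_tendsto (b := Filter.atTop) (f := fun n : ℕ => (S.f i₀)^[n] x) ?_
    (Filter.Eventually.of_forall hmem)
  rw [tendsto_iff_dist_tendsto_zero]
  have : ∀ n : ℕ, dist ((S.f i₀)^[n] x) 0 = S.r i₀ ^ n * dist x 0 := fun n => by
    rw [← dist_iterate S, h.iterate_zero]
  simp only [this]
  simpa using (tendsto_pow_atTop_nhds_zero_of_lt_one (S.r_pos i₀).le
    (S.r_lt_one i₀)).mul_const (dist x 0)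

/-- The union of the pieces of a cluster. -/
def cluster (S : IFS d) (k : S.ι → κ) (c : κ) : Set (EuclideanSpace ℝ (Fin d)) :=
  ⋃ i ∈ {i | k i = c}, S.f i '' S.attractor

lemma isClopenPart_cluster (h : S.Clustered i₀ k) (c : κ) :
    IsClopenPart S.attractor (cluster S k c) := by
  have hcl : ∀ A : Set S.ι, IsClosed (⋃ i ∈ A, S.f i '' S.attractor) := fun A =>
    A.toFinite.isClosed_biUnion fun i _ => isClosed_image S h.att.2.1 i h.isClosed Subset.rfl
  refine ⟨?_, hcl _, ?_⟩
  · refine iUnion₂_subset fun i _ => ?_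
    rintro _ ⟨x, hx, rfl⟩
    exact h.att.mem hx
  · convert hcl {i | k i ≠ c} using 1
    ext x
    simp only [cluster, mem_sdiff, mem_iUnion, mem_ofPred_eq, exists_prop, mem_image, not_exists,
      not_and]
    constructor
    · rintro ⟨hx, hne⟩
      obtain ⟨i, y, hy, rfl⟩ := h.att.exists_eq hx
      exact ⟨i, fun hi => hne i hi y hy rfl, y, hy, rfl⟩
    · rintro ⟨i, hi, y, hy, rfl⟩
      exact ⟨h.att.mem hy, fun j hj z hz e => hi ((h.cluster_eq _ _ _ hz _ hy e) ▸ hj)⟩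

lemma isClopenPart_image (h : S.Clustered i₀ k) {F : Set (EuclideanSpace ℝ (Fin d))}
    (hF : IsClopenPart S.attractor F) (i : S.ι)
    (hi : ∀ j, j ≠ i → ∀ x ∈ F, ∀ y ∈ S.attractor, S.f i x ≠ S.f j y) :
    IsClopenPart S.attractor (S.f i '' F) := by
  refine ⟨?_, isClosed_image S h.att.2.1 i hF.closed hF.subset, ?_⟩
  · rintro _ ⟨x, hx, rfl⟩
    exact h.att.mem (hF.subset hx)
  · have : S.attractor \ S.f i '' F =
        S.f i '' (S.attractor \ F) ∪ ⋃ j ∈ {j | j ≠ i}, S.f j '' S.attractor := by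
      ext x
      constructor
      · rintro ⟨hx, hne⟩
        obtain ⟨j, y, hy, rfl⟩ := h.att.exists_eq hx
        rcases eq_or_ne j i with rfl | hj
        · exact Or.inl ⟨y, ⟨hy, fun hyF => hne ⟨y, hyF, rfl⟩⟩, rfl⟩
        · exact Or.inr (mem_biUnion (show j ∈ {j | j ≠ i} from hj) ⟨y, hy, rfl⟩)
      · rintro (⟨y, ⟨hy, hyF⟩, rfl⟩ | hx)
        · refine ⟨h.att.mem hy, ?_⟩
          rintro ⟨z, hz, e⟩
          exact hyF (S.injective i e ▸ hz)
        · obtain ⟨j, hj, y, hy, rfl⟩ := mem_iUnion₂.1 hx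
          refine ⟨h.att.mem hy, ?_⟩
          rintro ⟨z, hz, e⟩
          exact hi j hj z hz y hy e
    rw [this]
    refine (isClosed_image S h.att.2.1 i hF.closed_diff sdiff_subset).union ?_
    exact (toFinite _).isClosed_biUnion fun j _ =>
      isClosed_image S h.att.2.1 j h.isClosed Subset.rfl

lemma isClopenPart_image_of_notMem (h : S.Clustered i₀ k) {F : Set (EuclideanSpace ℝ (Fin d))}
    (hF : IsClopenPart S.attractor F) (h0 : 0 ∉ F) (i : S.ι) :
    IsClopenPart S.attractor (S.f i '' F) :=
  h.isClopenPart_image hF i fun j hj x hx y hy e =>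
    h0 (h.eq_zero i j hj.symm x (hF.subset hx) y hy e ▸ hx)

lemma exists_clopenPart_zero (h : S.Clustered i₀ k) {x : EuclideanSpace ℝ (Fin d)} (hx : x ≠ 0) :
    ∃ G, IsClopenPart S.attractor G ∧ 0 ∈ G ∧ x ∉ G := by
  obtain ⟨D, hD⟩ := isBounded_iff.1 h.att.2.1.isBounded
  have hlim := (tendsto_pow_atTop_nhds_zero_of_lt_one (S.r_pos i₀).le
    (S.r_lt_one i₀)).mul_const D
  rw [zero_mul] at hlim
  obtain ⟨n, hn⟩ := (hlim.eventually_lt_const (dist_pos.2 hx)).exists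
  refine ⟨(S.f i₀)^[n] '' S.attractor, ?_, ⟨0, h.zero_mem, h.iterate_zero n⟩, ?_⟩
  · clear hn
    induction n with
    | zero => simpa using IsClopenPart.self h.isClosed
    | succ n ih =>
      rw [Function.iterate_succ', image_comp]
      exact h.isClopenPart_image ih i₀ fun j hj x hx y hy e =>
        hj (h.eq_of_cluster j (h.cluster_eq _ _ x (ih.subset hx) y hy e).symm)
  · rintro ⟨y, hy, rfl⟩
    have h1 := dist_iterate S i₀ n y 0
    rw [h.iterate_zero] at h1
    rw [h1] at hn
    exact hn.not_ge (mul_le_mul_of_nonneg_left (hD hy h.zero_mem) (pow_nonneg (S.r_pos i₀).le n))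

lemma exists_separating (h : S.Clustered i₀ k) {D ρ : ℝ}
    (hD : ∀ x ∈ S.attractor, ∀ y ∈ S.attractor, dist x y ≤ D) (hρ : ∀ i, S.r i ≤ ρ) (n : ℕ) :
    ∀ x ∈ S.attractor, ∀ y ∈ S.attractor, D * ρ ^ n < dist x y →
      ∃ F, IsClopenPart S.attractor F ∧ x ∈ F ∧ y ∉ F := by
  have hρ0 : 0 < ρ := (S.r_pos i₀).trans_le (hρ i₀)
  induction n with
  | zero =>
    intro x hx y hy hxy
    rw [pow_zero, mul_one] at hxy
    exact absurd (hD x hx y hy) hxy.not_ge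
  | succ n ih =>
    intro x hx y hy hxy
    obtain ⟨i, x, hx', rfl⟩ := h.att.exists_eq hx
    obtain ⟨j, y, hy', rfl⟩ := h.att.exists_eq hy
    by_cases hk : k i = k j
    swap
    · refine ⟨cluster S k (k i), h.isClopenPart_cluster _,
        mem_biUnion (show i ∈ {l | k l = k i} from rfl) ⟨x, hx', rfl⟩, fun hmem => ?_⟩
      obtain ⟨l, hl, z, hz, e⟩ := mem_iUnion₂.1 hmem
      exact hk (hl.symm.trans (h.cluster_eq _ _ z hz y hy' e))
    rcases eq_or_ne i j with rfl | hij
    · rw [S.sim] at hxy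
      have hxy' : D * ρ ^ n < dist x y := by
        have h1 : S.r i * dist x y ≤ ρ * dist x y :=
          mul_le_mul_of_nonneg_right (hρ i) dist_nonneg
        have h2 : ρ * (D * ρ ^ n) < ρ * dist x y := by
          rw [pow_succ] at hxy
          linarith
        exact lt_of_mul_lt_mul_left h2 hρ0.le
      obtain ⟨F, hF, hxF, hyF⟩ := ih x hx' y hy' hxy'
      by_cases h0 : (0 : EuclideanSpace ℝ (Fin d)) ∈ F
      · refine ⟨S.attractor \ S.f i '' (S.attractor \ F),
          (h.isClopenPart_image_of_notMem hF.diff (fun h => h.2 h0) i).diff, ⟨hx, ?_⟩,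
          fun h => h.2 ⟨y, ⟨hy', hyF⟩, rfl⟩⟩
        rintro ⟨z, hz, e⟩
        exact hz.2 (S.injective i e ▸ hxF)
      · refine ⟨S.f i '' F, h.isClopenPart_image_of_notMem hF h0 i, ⟨x, hxF, rfl⟩, ?_⟩
        rintro ⟨z, hz, e⟩
        exact hyF (S.injective i e ▸ hz)
    · by_cases hx0 : x = 0
      · have hy0 : y ≠ 0 := by
          rintro rfl
          rw [hx0, h.vertex i j hk, dist_self] at hxy
          have hD0 : 0 ≤ D := by simpa using hD _ h.zero_mem _ h.zero_mem
          exact hxy.not_ge (by positivity)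
        obtain ⟨G, hG, h0G, hyG⟩ := h.exists_clopenPart_zero hy0
        refine ⟨S.attractor \ S.f j '' (S.attractor \ G),
          (h.isClopenPart_image_of_notMem hG.diff (fun h => h.2 h0G) j).diff, ⟨hx, ?_⟩,
          fun h => h.2 ⟨y, ⟨hy', hyG⟩, rfl⟩⟩
        rintro ⟨z, hz, e⟩
        exact hz.2 (h.eq_zero j i hij.symm z hz.1 x hx' e ▸ h0G)
      · obtain ⟨G, hG, h0G, hxG⟩ := h.exists_clopenPart_zero hx0
        refine ⟨S.f i '' (S.attractor \ G),
          h.isClopenPart_image_of_notMem hG.diff (fun h => h.2 h0G) i, ⟨x, ⟨hx', hxG⟩, rfl⟩, ?_⟩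
        rintro ⟨z, hz, e⟩
        exact hz.2 (h.eq_zero i j hij z hz.1 y hy' e ▸ h0G)

theorem isTotallyDisconnected (h : S.Clustered i₀ k) : IsTotallyDisconnected S.attractor := by
  have := h.att.nonempty
  obtain ⟨ρ, hρ0, hρ1, hρ⟩ := S.exists_ratio_bound
  obtain ⟨D, hD⟩ := isBounded_iff.1 h.att.2.1.isBounded
  refine isTotallyDisconnected_of_separated fun x hx y hy hxy => ?_
  have hlim := (tendsto_pow_atTop_nhds_zero_of_lt_one hρ0.le hρ1).const_mul D
  rw [mul_zero] at hlim
  obtain ⟨n, hn⟩ := (hlim.eventually_lt_const (dist_pos.2 hxy)).exists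
  exact h.exists_separating (fun x hx y hy => hD hx hy) hρ n x hx y hy hn

/-! ### Natural measures of clopen parts -/

section Measure

variable {s p : ℝ} {e : S.ι → ℕ} {F : Set (EuclideanSpace ℝ (Fin d))}

lemma natMeasure_eq (S : IFS d) (F : Set (EuclideanSpace ℝ (Fin d))) :
    S.natMeasure F = (μH[S.hdim] F).toReal / (μH[S.hdim] S.attractor).toReal :=
  ENNReal.toReal_div _ _

lemma natMeasure_eq_sum (h : S.Clustered i₀ k) (hpos : 0 < S.hdim)
    (htop : μH[S.hdim] S.attractor ≠ ⊤) (hF : IsClosed F) (hFS : F ⊆ S.attractor) :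
    S.natMeasure F = ∑ i, S.r i ^ S.hdim * S.natMeasure (S.attractor ∩ S.f i ⁻¹' F) := by
  have hF_eq : F = ⋃ i, S.f i '' (S.attractor ∩ S.f i ⁻¹' F) := by
    ext x
    simp only [mem_iUnion, mem_image]
    constructor
    · intro hx
      obtain ⟨i, y, hy, rfl⟩ := h.att.exists_eq (hFS hx)
      exact ⟨i, y, ⟨hy, hx⟩, rfl⟩
    · rintro ⟨i, y, hy, rfl⟩
      exact hy.2
  have hsingle : NullSingletonClass (μH[S.hdim] : Measure (EuclideanSpace ℝ (Fin d))) :=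
    Measure.nullSingletonClass_hausdorff _ hpos
  have hmeas : μH[S.hdim] F =
      ∑ i, (S.ratio i : ℝ≥0∞) ^ S.hdim * μH[S.hdim] (S.attractor ∩ S.f i ⁻¹' F) := by
    conv_lhs => rw [hF_eq]
    rw [measure_iUnion₀, tsum_fintype]
    · exact Finset.sum_congr rfl fun i _ => S.hausdorffMeasure_image hpos.le i _
    · intro i j hij
      refine measure_mono_null (t := {S.f i 0}) ?_ (measure_singleton _)
      rintro _ ⟨⟨x, hx, rfl⟩, ⟨y, hy, e⟩⟩
      rw [h.eq_zero i j hij x hx.1 y hy.1 e.symm]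
      rfl
    · intro i
      refine (isClosed_image S h.att.2.1 i ?_ inter_subset_left).measurableSet.nullMeasurableSet
      exact h.isClosed.inter (hF.preimage (S.lipschitzWith i).continuous)
  rw [natMeasure_eq, hmeas, ENNReal.toReal_sum, Finset.sum_div]
  · refine Finset.sum_congr rfl fun i _ => ?_
    rw [natMeasure_eq, ENNReal.toReal_mul, S.ratio_rpow hpos.le,
      ENNReal.toReal_ofReal (Real.rpow_nonneg (S.r_pos i).le _), mul_div_assoc]
  · intro i _
    exact ENNReal.mul_ne_top (ENNReal.rpow_ne_top_of_nonneg hpos.le ENNReal.coe_ne_top)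
      (ne_top_of_le_ne_top htop (measure_mono inter_subset_left))

lemma natMeasure_diff (S : IFS d) (htop : μH[S.hdim] S.attractor ≠ ⊤)
    (hzero : μH[S.hdim] S.attractor ≠ 0) (hF : IsClosed F) (hFS : F ⊆ S.attractor) :
    S.natMeasure (S.attractor \ F) = 1 - S.natMeasure F := by
  have hFtop : μH[S.hdim] F ≠ ⊤ := ne_top_of_le_ne_top htop (measure_mono hFS)
  rw [natMeasure_eq, natMeasure_eq, measure_sdiff hFS hF.measurableSet.nullMeasurableSet hFtop,
    ENNReal.toReal_sub_of_le (measure_mono hFS) htop, sub_div,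
    div_self (ENNReal.toReal_ne_zero.2 ⟨hzero, htop⟩)]

lemma natMeasure_empty (S : IFS d) : S.natMeasure ∅ = 0 := by simp [natMeasure_eq]

lemma natMeasure_attractor (S : IFS d) (htop : μH[S.hdim] S.attractor ≠ ⊤)
    (hzero : μH[S.hdim] S.attractor ≠ 0) : S.natMeasure S.attractor = 1 := by
  rw [natMeasure_eq, div_self (ENNReal.toReal_ne_zero.2 ⟨hzero, htop⟩)]

open scoped Classical in
lemma sum_vertex_mem [DecidableEq κ] (h : S.Clustered i₀ k) {I : Ideal (Zring p)}
    (hI : ∀ c, c ≠ k i₀ → ∑ i with k i = c, Zring.gen p ^ e i ∈ I) (h0 : 0 ∉ F) :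
    ∑ i with S.f i 0 ∈ F, Zring.gen p ^ e i ∈ I := by
  rw [← Finset.sum_fiberwise_of_maps_to
    (fun i hi => Finset.mem_image_of_mem k hi : ∀ i ∈ Finset.univ.filter (S.f · 0 ∈ F), _)]
  refine I.sum_mem fun c hc => ?_
  obtain ⟨j, hj, rfl⟩ := Finset.mem_image.1 hc
  rw [Finset.mem_filter] at hj
  have : ((Finset.univ.filter (S.f · 0 ∈ F)).filter fun i => k i = k j) =
      Finset.univ.filter fun i => k i = k j := by
    ext i
    simp only [Finset.mem_filter, Finset.mem_univ, true_and, and_iff_right_iff_imp]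
    intro hi
    rw [h.vertex i j hi]
    exact hj.2
  rw [this]
  refine hI _ fun hk => h0 ?_
  rw [← h.map_zero, ← h.eq_of_cluster j hk]
  exact hj.2

lemma natMeasure_mem_of_separated [DecidableEq κ] (h : S.Clustered i₀ k) (hpos : 0 < S.hdim)
    (htop : μH[S.hdim] S.attractor ≠ ⊤) (hzero : μH[S.hdim] S.attractor ≠ 0)
    (he : ∀ i, S.r i ^ S.hdim = p ^ e i) {I : Ideal (Zring p)}
    (hI : ∀ c, c ≠ k i₀ → ∑ i with k i = c, Zring.gen p ^ e i ∈ I) {D ρ : ℝ}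
    (hD : ∀ x ∈ S.attractor, ∀ y ∈ S.attractor, dist x y ≤ D) (hρ : ∀ i, S.r i ≤ ρ) (n : ℕ)
    (F : Set (EuclideanSpace ℝ (Fin d))) (hF : IsClopenPart S.attractor F) (h0 : 0 ∉ F)
    (hsep : ∀ x ∈ F, ∀ y ∈ S.attractor \ F, D * ρ ^ n < dist x y) :
    ∃ a ∈ I, S.natMeasure F = (a : ℝ) := by
  classical
  have hρ0 : 0 < ρ := (S.r_pos i₀).trans_le (hρ i₀)
  induction n generalizing F with
  | zero =>
    rcases F.eq_empty_or_nonempty with rfl | ⟨x, hx⟩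
    · exact ⟨0, I.zero_mem, natMeasure_empty S⟩
    · have h1 := hsep x hx 0 ⟨h.zero_mem, h0⟩
      rw [pow_zero, mul_one] at h1
      exact absurd (hD x (hF.subset hx) 0 h.zero_mem) h1.not_ge
  | succ n ih =>
    have hpre : ∀ i, IsClopenPart S.attractor (S.attractor ∩ S.f i ⁻¹' F) := fun i =>
      hF.preimage h.isClosed (S.lipschitzWith i).continuous fun x hx => h.att.mem hx
    have hsep' : ∀ i, ∀ x ∈ S.attractor ∩ S.f i ⁻¹' F,
        ∀ y ∈ S.attractor \ (S.attractor ∩ S.f i ⁻¹' F), D * ρ ^ n < dist x y := by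
      intro i x hx y hy
      have h1 := hsep _ hx.2 (S.f i y) ⟨h.att.mem hy.1, fun hyF => hy.2 ⟨hy.1, hyF⟩⟩
      rw [S.sim, pow_succ] at h1
      have h2 : S.r i * dist x y ≤ ρ * dist x y := mul_le_mul_of_nonneg_right (hρ i) dist_nonneg
      have h3 : ρ * (D * ρ ^ n) < ρ * dist x y := by linarith
      exact lt_of_mul_lt_mul_left h3 hρ0.le
    have key : ∀ i, ∃ a ∈ I, S.natMeasure (S.attractor ∩ S.f i ⁻¹' F) =
        (a : ℝ) + if S.f i 0 ∈ F then 1 else 0 := by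
      intro i
      split_ifs with hi
      · obtain ⟨a, ha, e⟩ := ih _ (hpre i).diff (fun hmem => hmem.2 ⟨h.zero_mem, hi⟩)
          (fun x hx y hy => by
            rw [dist_comm]
            refine hsep' i y ?_ x hx
            rwa [sdiff_sdiff_cancel_left (hpre i).subset] at hy)
        refine ⟨-a, I.neg_mem ha, ?_⟩
        rw [natMeasure_diff S htop hzero (hpre i).closed (hpre i).subset] at e
        push_cast
        linarith
      · obtain ⟨a, ha, e⟩ := ih _ (hpre i) (fun hmem => hi hmem.2) (hsep' i)
        exact ⟨a, ha, by rw [e, add_zero]⟩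
    choose a ha hae using key
    refine ⟨∑ i, Zring.gen p ^ e i * a i + ∑ i with S.f i 0 ∈ F, Zring.gen p ^ e i,
      I.add_mem (I.sum_mem fun i _ => I.mul_mem_left _ (ha i)) (h.sum_vertex_mem hI h0), ?_⟩
    rw [h.natMeasure_eq_sum hpos htop hF.closed hF.subset, Finset.sum_filter,
      ← Finset.sum_add_distrib]
    push_cast
    refine Finset.sum_congr rfl fun i _ => ?_
    rw [hae, he]
    split_ifs <;> push_cast <;> simp [Zring.gen, mul_add]

lemma natMeasure_mem [DecidableEq κ] (h : S.Clustered i₀ k) (hpos : 0 < S.hdim)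
    (htop : μH[S.hdim] S.attractor ≠ ⊤) (hzero : μH[S.hdim] S.attractor ≠ 0)
    (he : ∀ i, S.r i ^ S.hdim = p ^ e i) {I : Ideal (Zring p)}
    (hI : ∀ c, c ≠ k i₀ → ∑ i with k i = c, Zring.gen p ^ e i ∈ I)
    (hF : IsClopenPart S.attractor F) (h0 : 0 ∉ F) : ∃ a ∈ I, S.natMeasure F = (a : ℝ) := by
  have := h.att.nonempty
  obtain ⟨ρ, hρ0, hρ1, hρ⟩ := S.exists_ratio_bound
  obtain ⟨D, hD⟩ := isBounded_iff.1 h.att.2.1.isBounded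
  obtain ⟨δ, hδ0, hδ⟩ := exists_pos_forall_lt_edist
    (h.att.2.1.of_isClosed_subset hF.closed hF.subset) hF.closed_diff disjoint_sdiff_right
  have hlim := (tendsto_pow_atTop_nhds_zero_of_lt_one hρ0.le hρ1).const_mul D
  rw [mul_zero] at hlim
  obtain ⟨n, hn⟩ := (hlim.eventually_lt_const (NNReal.coe_pos.2 hδ0)).exists
  refine h.natMeasure_mem_of_separated hpos htop hzero he hI
    (fun x hx y hy => hD hx hy) hρ n F hF h0 fun x hx y hy => hn.trans ?_
  have h1 := hδ x hx y hy
  rw [edist_nndist] at h1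
  exact_mod_cast h1

lemma natMeasure_cluster (h : S.Clustered i₀ k) (hpos : 0 < S.hdim)
    (htop : μH[S.hdim] S.attractor ≠ ⊤) (hzero : μH[S.hdim] S.attractor ≠ 0)
    (he : ∀ i, S.r i ^ S.hdim = p ^ e i) [DecidableEq κ] (c : κ) :
    S.natMeasure (cluster S k c) = ((∑ i with k i = c, Zring.gen p ^ e i : Zring p) : ℝ) := by
  have hc := h.isClopenPart_cluster c
  rw [h.natMeasure_eq_sum hpos htop hc.closed hc.subset, Finset.sum_filter]
  push_cast
  refine Finset.sum_congr rfl fun i _ => ?_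
  split_ifs with hi
  · have : S.attractor ∩ S.f i ⁻¹' cluster S k c = S.attractor :=
      inter_eq_left.2 fun x hx => mem_biUnion (show i ∈ {l | k l = c} from hi) ⟨x, hx, rfl⟩
    rw [this, natMeasure_attractor S htop hzero, he]
    simp [Zring.gen]
  · have : S.attractor ∩ S.f i ⁻¹' cluster S k c = ∅ := by
      rw [eq_empty_iff_forall_notMem]
      rintro x ⟨hx, hxc⟩
      obtain ⟨l, hl, z, hz, e⟩ := mem_iUnion₂.1 hxc
      exact hi ((h.cluster_eq _ _ z hz x hx e).symm.trans hl)
    rw [this, natMeasure_empty]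
    simp

/-- The ideal of a clustered system is generated by the natural measures of its clusters. -/
theorem idealOf_eq (h : S.Clustered i₀ k) (hpos : 0 < S.hdim)
    (htop : μH[S.hdim] S.attractor ≠ ⊤) (hzero : μH[S.hdim] S.attractor ≠ 0)
    (he : ∀ i, S.r i ^ S.hdim = p ^ e i) [DecidableEq κ] {O : Set (EuclideanSpace ℝ (Fin d))}
    (hO : S.OSCSet O) (hOc : ∀ i, i ≠ i₀ → S.f i '' S.attractor ⊆ O)
    (hk : ∃ i j, i ≠ j ∧ k i = k j) {I : Ideal (Zring p)}
    (hI : I = Ideal.span {x | ∃ c, c ≠ k i₀ ∧ x = ∑ i with k i = c, Zring.gen p ^ e i}) :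
    S.idealOf p = I := by
  have hIc : ∀ c, c ≠ k i₀ → ∑ i with k i = c, Zring.gen p ^ e i ∈ I := fun c hc => by
    rw [hI]
    exact Ideal.subset_span ⟨c, hc, rfl⟩
  refine le_antisymm (Ideal.span_le.2 ?_) ?_
  · rintro x ⟨F, ⟨hF, hFS, hFd, O', hO', hFO⟩, hx⟩
    have h0 : 0 ∉ F := by
      intro h0
      obtain ⟨i, j, hij, hkij⟩ := hk
      refine disjoint_left.1 (hO'.2.2.2.2 i j hij) ⟨0, hFO h0, rfl⟩ ⟨0, hFO h0, ?_⟩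
      exact (h.vertex i j hkij).symm
    obtain ⟨a, ha, e⟩ := h.natMeasure_mem hpos htop hzero he hIc
      ⟨hFS, hF.isClosed, hFd.isClosed⟩ h0
    rwa [Subtype.ext (hx.trans e)]
  · rw [hI, Ideal.span_le]
    rintro _ ⟨c, hc, rfl⟩
    refine Ideal.subset_span ⟨cluster S k c, ?_, (h.natMeasure_cluster hpos htop hzero he c).symm⟩
    have hcl := h.isClopenPart_cluster c
    refine ⟨h.att.2.1.of_isClosed_subset hcl.closed hcl.subset, hcl.subset,
      h.att.2.1.of_isClosed_subset hcl.closed_diff sdiff_subset, O, hO, ?_⟩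
    refine iUnion₂_subset fun i hi => hOc i ?_
    rintro rfl
    exact hc hi.symm

end Measure

end Clustered

end IFS

/-! ### Existence and location of the attractor -/

namespace IFS

variable {d : ℕ}

/-- The orbit of the origin under the semigroup generated by an IFS. -/
inductive ZeroOrbit (S : IFS d) : EuclideanSpace ℝ (Fin d) → Prop
  | zero : ZeroOrbit S 0
  | map (i : S.ι) (x : EuclideanSpace ℝ (Fin d)) : ZeroOrbit S x → ZeroOrbit S (S.f i x)

lemma exists_isAttractor (S : IFS d) {i₀ : S.ι} (h0 : S.f i₀ 0 = 0)
    {K : Set (EuclideanSpace ℝ (Fin d))} (hK : IsCompact K) (h0K : 0 ∈ K)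
    (hSK : ∀ i, MapsTo (S.f i) K K) : ∃ E, S.IsAttractor E := by
  set R : Set (EuclideanSpace ℝ (Fin d)) := {x | S.ZeroOrbit x} with hR
  have hRK : R ⊆ K := by
    intro x hx
    induction hx with
    | zero => exact h0K
    | map i x _ ih => exact hSK i ih
  have hcomp : IsCompact (closure R) :=
    hK.of_isClosed_subset isClosed_closure (closure_minimal hRK hK.isClosed)
  have hR_eq : R = ⋃ i, S.f i '' R := by
    ext x
    simp only [mem_iUnion, mem_image]
    constructor
    · rintro (_ | ⟨i, x, hx⟩)
      · exact ⟨i₀, 0, .zero, h0⟩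
      · exact ⟨i, x, hx, rfl⟩
    · rintro ⟨i, y, hy, rfl⟩
      exact .map i y hy
  refine ⟨closure R, ⟨0, subset_closure ZeroOrbit.zero⟩, hcomp, ?_⟩
  conv_lhs => rw [hR_eq, closure_iUnion_of_finite]
  refine iUnion_congr fun i => ?_
  exact (image_closure_of_isCompact hcomp (S.lipschitzWith i).continuous.continuousOn).symm

lemma IsAttractor.subset_of_mapsTo {S : IFS d} {E K : Set (EuclideanSpace ℝ (Fin d))}
    (hE : S.IsAttractor E) (hK : IsCompact K) (hKne : K.Nonempty)
    (hSK : ∀ i, MapsTo (S.f i) K K) : E ⊆ K := by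
  obtain ⟨x, hx, hmax⟩ := hE.2.1.exists_isMaxOn hE.1 (continuous_infDist_pt K).continuousOn
  have hzero : infDist x K ≤ 0 := by
    obtain ⟨i, y, hy, rfl⟩ := hE.exists_eq hx
    obtain ⟨z, hz, hyz⟩ := hK.exists_infDist_eq_dist hKne y
    have h1 : infDist (S.f i y) K ≤ S.r i * infDist y K := by
      rw [hyz, ← S.sim]
      exact infDist_le_dist_of_mem (hSK i hz)
    have h2 : infDist y K ≤ infDist (S.f i y) K := hmax hy
    have h3 := S.r_lt_one i
    have h4 := S.r_pos i
    nlinarith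
  intro y hy
  refine (hK.isClosed.mem_iff_infDist_zero hKne).2 (le_antisymm ?_ infDist_nonneg)
  exact (hmax hy).trans hzero

end IFS

/-! ### A clustered system with prescribed ratios -/

/-- The combinatorial data of a clustered system: an axis `o`, an axis `a i` for each map, an
axis `b c` for each cluster, the cluster `k i` of each map, and small contraction ratios. -/
structure ClusterData (d : ℕ) (α κ : Type) where
  o : Fin d
  a : α → Fin d
  b : κ → Fin d
  a_inj : Function.Injective a
  b_inj : Function.Injective b
  a_ne_o : ∀ i, a i ≠ o
  b_ne_o : ∀ c, b c ≠ o
  a_ne_b : ∀ i c, a i ≠ b c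
  k : α → κ
  ρ : Option α → ℝ
  ρ_pos : ∀ i, 0 < ρ i
  ρ_le : ∀ i, ρ i ≤ 1 / 20

namespace ClusterData

variable {d : ℕ} {α κ : Type} (D : ClusterData d α κ)

/-- The common vertex of the pieces of a cluster. -/
def vertex (c : κ) : EuclideanSpace ℝ (Fin d) :=
  EuclideanSpace.single D.o 1 + EuclideanSpace.single (D.b c) (1 / 2)

/-- The maps of the system: a homothety at the origin, and for every `i` a scaled copy of the
coordinate swap of `o` and `a i`, translated to the vertex of the cluster of `i`. -/
def map : Option α → EuclideanSpace ℝ (Fin d) → EuclideanSpace ℝ (Fin d)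
  | none, x => D.ρ none • x
  | some i, x => D.vertex (D.k i) +
      D.ρ (some i) • LinearIsometryEquiv.piLpCongrLeft 2 ℝ ℝ (Equiv.swap D.o (D.a i)) x

/-- The iterated function system attached to the data. -/
def toIFS [Fintype α] : IFS d where
  ι := Option α
  fin := inferInstance
  f := D.map
  r := D.ρ
  r_pos := D.ρ_pos
  r_lt_one i := (D.ρ_le i).trans_lt (by norm_num)
  sim i x y := by
    cases i with
    | none => rw [map, map, dist_smul₀, Real.norm_of_nonneg (D.ρ_pos _).le]
    | some i =>
      rw [map, map, dist_add_left, dist_smul₀, Real.norm_of_nonneg (D.ρ_pos _).le,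
        LinearIsometryEquiv.dist_map]

lemma vertex_o (c : κ) : D.vertex c D.o = 1 := by
  simp [vertex, (D.b_ne_o c).symm]

lemma vertex_a (c : κ) (i : α) : D.vertex c (D.a i) = 0 := by
  simp [vertex, D.a_ne_o i, D.a_ne_b i c]

lemma vertex_b_self (c : κ) : D.vertex c (D.b c) = 1 / 2 := by
  simp [vertex, D.b_ne_o c]

lemma vertex_b_of_ne {c c' : κ} (h : c ≠ c') : D.vertex c (D.b c') = 0 := by
  simp [vertex, D.b_ne_o c', D.b_inj.ne h.symm]

lemma abs_vertex_le (c : κ) {j : Fin d} (hj : j ≠ D.o) : |D.vertex c j| ≤ 1 / 2 := by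
  rcases eq_or_ne j (D.b c) with rfl | h
  · rw [vertex_b_self]; norm_num
  · simp [vertex, hj, h]

lemma map_none_apply (x : EuclideanSpace ℝ (Fin d)) (j : Fin d) :
    D.map none x j = D.ρ none * x j := rfl

lemma map_some_apply (i : α) (x : EuclideanSpace ℝ (Fin d)) (j : Fin d) :
    D.map (some i) x j =
      D.vertex (D.k i) j + D.ρ (some i) * x (Equiv.swap D.o (D.a i) j) := rfl

lemma map_some_self (i : α) (x : EuclideanSpace ℝ (Fin d)) :
    D.map (some i) x (D.a i) = D.ρ (some i) * x D.o := by
  rw [map_some_apply, vertex_a, Equiv.swap_apply_right, zero_add]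

lemma map_some_of_ne {i j : α} (h : i ≠ j) (x : EuclideanSpace ℝ (Fin d)) :
    D.map (some i) x (D.a j) = D.ρ (some i) * x (D.a j) := by
  rw [map_some_apply, vertex_a, Equiv.swap_apply_of_ne_of_ne (D.a_ne_o j) (D.a_inj.ne h.symm),
    zero_add]

lemma abs_mul_le (i : Option α) {t : ℝ} (ht : |t| ≤ 2) : |D.ρ i * t| ≤ 1 / 10 := by
  rw [abs_mul, abs_of_pos (D.ρ_pos i)]
  have := D.ρ_le i
  have := D.ρ_pos i
  have := abs_nonneg t
  nlinarith

/-- The cube with side four centred at the origin. -/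
def cube (d : ℕ) : Set (EuclideanSpace ℝ (Fin d)) := {x | ∀ j, |x j| ≤ 2}

lemma isCompact_cube : IsCompact (cube d) := by
  have h := (isCompact_univ_pi fun _ : Fin d => isCompact_Icc (a := (-2 : ℝ)) (b := 2)).image
    (PiLp.continuous_toLp 2 fun _ : Fin d => ℝ)
  convert h using 1
  ext x
  constructor
  · exact fun hx => ⟨x.ofLp, fun j _ => abs_le.1 (hx j), rfl⟩
  · rintro ⟨y, hy, rfl⟩ j
    exact abs_le.2 (hy j (mem_univ j))

/-- The compact cone containing the attractor. -/
def cone : Set (EuclideanSpace ℝ (Fin d)) :=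
  {x | (∀ j, j ≠ D.o → |x j| ≤ 3 / 4 * x D.o) ∧ 0 ≤ x D.o ∧ x D.o ≤ 2}

/-- The open cone witnessing the open set condition. -/
def openCone : Set (EuclideanSpace ℝ (Fin d)) :=
  {x | (∀ j, j ≠ D.o → |x j| < x D.o) ∧ 0 < x D.o ∧ x D.o < 2}

lemma cone_subset_cube : D.cone ⊆ cube d := by
  rintro x ⟨h1, h2, h3⟩ j
  rcases eq_or_ne j D.o with rfl | hj
  · rwa [abs_of_nonneg h2]
  · linarith [h1 j hj]

lemma openCone_subset_cube : D.openCone ⊆ cube d := by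
  rintro x ⟨h1, h2, h3⟩ j
  rcases eq_or_ne j D.o with rfl | hj
  · rw [abs_of_pos h2]; exact h3.le
  · linarith [h1 j hj]

lemma continuous_coord (j : Fin d) : Continuous fun x : EuclideanSpace ℝ (Fin d) => x j := by
  fun_prop

lemma isCompact_cone : IsCompact D.cone := by
  refine isCompact_cube.of_isClosed_subset ?_ D.cone_subset_cube
  simp only [cone, ofPred_and, ofPred_forall]
  refine IsClosed.inter (isClosed_iInter fun j => isClosed_iInter fun _ => ?_)
    (IsClosed.inter ?_ ?_)
  · exact isClosed_le (continuous_coord j).abs (continuous_const.mul (continuous_coord _))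
  · exact isClosed_le continuous_const (continuous_coord _)
  · exact isClosed_le (continuous_coord _) continuous_const

lemma isOpen_openCone : IsOpen D.openCone := by
  simp only [openCone, ofPred_and, ofPred_forall]
  refine IsOpen.inter (isOpen_iInter_of_finite fun j => isOpen_iInter_of_finite fun _ => ?_)
    (IsOpen.inter ?_ ?_)
  · exact isOpen_lt (continuous_coord j).abs (continuous_coord _)
  · exact isOpen_lt continuous_const (continuous_coord _)
  · exact isOpen_lt (continuous_coord _) continuous_const

lemma zero_mem_cone : 0 ∈ D.cone := by
  refine ⟨fun j _ => ?_, ?_, ?_⟩ <;> simp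

lemma eq_zero_of_mem_cone {x : EuclideanSpace ℝ (Fin d)} (hx : x ∈ D.cone) (h : x D.o ≤ 0) :
    x = 0 := by
  have h0 : x D.o = 0 := le_antisymm h hx.2.1
  ext j
  rcases eq_or_ne j D.o with rfl | hj
  · exact h0
  · have := hx.1 j hj
    rw [h0, mul_zero] at this
    exact abs_nonpos_iff.1 this

section Bounds

variable {x y : EuclideanSpace ℝ (Fin d)}

lemma map_some_o (hx : x ∈ cube d) (i : α) :
    9 / 10 ≤ D.map (some i) x D.o ∧ D.map (some i) x D.o ≤ 11 / 10 := by
  rw [map_some_apply, vertex_o]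
  have := abs_le.1 (D.abs_mul_le (some i) (hx (Equiv.swap D.o (D.a i) D.o)))
  constructor <;> linarith

lemma abs_map_some (hx : x ∈ cube d) (i : α) {j : Fin d} (hj : j ≠ D.o) :
    |D.map (some i) x j| ≤ 6 / 10 := by
  rw [map_some_apply]
  have h1 := D.abs_mul_le (some i) (hx (Equiv.swap D.o (D.a i) j))
  have h2 := D.abs_vertex_le (D.k i) hj
  have h3 := abs_add_le (D.vertex (D.k i) j) (D.ρ (some i) * x (Equiv.swap D.o (D.a i) j))
  linarith

lemma map_some_mem_cone (hx : x ∈ cube d) (i : α) : D.map (some i) x ∈ D.cone := by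
  have h := D.map_some_o hx i
  refine ⟨fun j hj => ?_, by linarith, by linarith⟩
  have := D.abs_map_some hx i hj
  linarith

lemma map_some_mem_openCone (hx : x ∈ cube d) (i : α) : D.map (some i) x ∈ D.openCone := by
  have h := D.map_some_o hx i
  refine ⟨fun j hj => ?_, by linarith, by linarith⟩
  have := D.abs_map_some hx i hj
  linarith

lemma map_none_ne_map_some (hx : x ∈ cube d) (hy : y ∈ cube d) (i : α) :
    D.map none x ≠ D.map (some i) y := by
  intro h
  have h1 := (D.map_some_o hy i).1
  rw [← h, map_none_apply] at h1
  have := abs_le.1 (D.abs_mul_le none (hx D.o))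
  linarith

lemma cluster_eq_of_map_some_eq (hx : x ∈ cube d) (hy : y ∈ cube d) {i j : α}
    (h : D.map (some i) x = D.map (some j) y) : D.k i = D.k j := by
  by_contra hk
  have h1 := congrArg (fun z : EuclideanSpace ℝ (Fin d) => z (D.b (D.k i))) h
  simp only [map_some_apply, vertex_b_self, D.vertex_b_of_ne (Ne.symm hk)] at h1
  have h2 := abs_le.1 (D.abs_mul_le (some i) (hx (Equiv.swap D.o (D.a i) (D.b (D.k i)))))
  have h3 := abs_le.1 (D.abs_mul_le (some j) (hy (Equiv.swap D.o (D.a j) (D.b (D.k i)))))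
  linarith

end Bounds

lemma mapsTo_cone (i : Option α) : MapsTo (D.map i) D.cone D.cone := by
  intro x hx
  cases i with
  | some i => exact D.map_some_mem_cone (D.cone_subset_cube hx) i
  | none =>
    have h1 := D.ρ_pos none
    have h2 := D.ρ_le none
    obtain ⟨h3, h4, h5⟩ := hx
    refine ⟨fun j hj => ?_, ?_, ?_⟩
    · rw [map_none_apply, map_none_apply, abs_mul, abs_of_pos h1]
      nlinarith [h3 j hj]
    · rw [map_none_apply]; positivity
    · rw [map_none_apply]; nlinarith

lemma mapsTo_openCone (i : Option α) : MapsTo (D.map i) D.openCone D.openCone := by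
  intro x hx
  cases i with
  | some i => exact D.map_some_mem_openCone (D.openCone_subset_cube hx) i
  | none =>
    have h1 := D.ρ_pos none
    have h2 := D.ρ_le none
    obtain ⟨h3, h4, h5⟩ := hx
    refine ⟨fun j hj => ?_, ?_, ?_⟩
    · rw [map_none_apply, map_none_apply, abs_mul, abs_of_pos h1]
      exact mul_lt_mul_of_pos_left (h3 j hj) h1
    · rw [map_none_apply]; positivity
    · rw [map_none_apply]; nlinarith

lemma map_some_coord_eq {i j : α} (hij : i ≠ j) {x y : EuclideanSpace ℝ (Fin d)}
    (h : D.map (some i) x = D.map (some j) y) :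
    D.ρ (some i) * x D.o = D.ρ (some j) * y (D.a i) ∧
      D.ρ (some i) * x (D.a j) = D.ρ (some j) * y D.o := by
  constructor
  · rw [← map_some_self, h, D.map_some_of_ne hij.symm]
  · rw [← D.map_some_of_ne hij, h, map_some_self]

lemma eq_zero_of_map_some_eq {i j : α} (hij : i ≠ j) {x y : EuclideanSpace ℝ (Fin d)}
    (hx : x ∈ D.cone) (hy : y ∈ D.cone) (h : D.map (some i) x = D.map (some j) y) : x = 0 := by
  obtain ⟨h1, h2⟩ := D.map_some_coord_eq hij h
  have h3 := (le_abs_self _).trans (hy.1 _ (D.a_ne_o i))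
  have h4 := (le_abs_self _).trans (hx.1 _ (D.a_ne_o j))
  have hi := D.ρ_pos (some i)
  have hj := D.ρ_pos (some j)
  have h5 := mul_le_mul_of_nonneg_left h3 hj.le
  have h6 := mul_le_mul_of_nonneg_left h4 hi.le
  refine D.eq_zero_of_mem_cone hx (nonpos_of_mul_nonpos_right ?_ hi)
  linarith

lemma map_some_ne {i j : α} (hij : i ≠ j) {x y : EuclideanSpace ℝ (Fin d)}
    (hx : x ∈ D.openCone) (hy : y ∈ D.openCone) : D.map (some i) x ≠ D.map (some j) y := by
  intro h
  obtain ⟨h1, h2⟩ := D.map_some_coord_eq hij h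
  have h3 := (le_abs_self _).trans_lt (hy.1 _ (D.a_ne_o i))
  have h4 := (le_abs_self _).trans_lt (hx.1 _ (D.a_ne_o j))
  have h5 := mul_lt_mul_of_pos_left h3 (D.ρ_pos (some j))
  have h6 := mul_lt_mul_of_pos_left h4 (D.ρ_pos (some i))
  linarith

variable [Fintype α]

lemma oscSet : D.toIFS.OSCSet D.openCone := by
  refine ⟨⟨EuclideanSpace.single D.o 1, ?_, ?_, ?_⟩, D.isOpen_openCone,
    isCompact_cube.isBounded.subset D.openCone_subset_cube,
    fun i => (D.mapsTo_openCone i).image_subset, ?_⟩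
  · intro j hj
    simp [hj]
  · simp
  · simp
  · rintro i j hij
    rw [disjoint_left]
    rintro _ ⟨x, hx, rfl⟩ ⟨y, hy, h⟩
    have hx' := D.openCone_subset_cube hx
    have hy' := D.openCone_subset_cube hy
    cases i with
    | none =>
      cases j with
      | none => exact hij rfl
      | some j => exact D.map_none_ne_map_some hx' hy' j h.symm
    | some i =>
      cases j with
      | none => exact D.map_none_ne_map_some hy' hx' i h
      | some j => exact D.map_some_ne (fun e => hij (congrArg some e)) hx hy h.symm

lemma map_none_zero : D.toIFS.f none 0 = 0 := smul_zero (D.ρ none)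

lemma isAttractor : D.toIFS.IsAttractor D.toIFS.attractor :=
  D.toIFS.isAttractor_attractor
    (D.toIFS.exists_isAttractor D.map_none_zero D.isCompact_cone D.zero_mem_cone D.mapsTo_cone)

lemma attractor_subset : D.toIFS.attractor ⊆ D.cone :=
  D.isAttractor.subset_of_mapsTo D.isCompact_cone ⟨0, D.zero_mem_cone⟩ D.mapsTo_cone

theorem clustered : D.toIFS.Clustered (none : Option α) (Option.map D.k) where
  att := D.isAttractor
  map_zero := D.map_none_zero
  eq_of_cluster i hi := Option.map_eq_none_iff.1 hi
  cluster_eq := by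
    intro i j x hx y hy h
    have hx' := D.cone_subset_cube (D.attractor_subset hx)
    have hy' := D.cone_subset_cube (D.attractor_subset hy)
    cases i with
    | none =>
      cases j with
      | none => rfl
      | some j => exact absurd h (D.map_none_ne_map_some hx' hy' j)
    | some i =>
      cases j with
      | none => exact absurd h.symm (D.map_none_ne_map_some hy' hx' i)
      | some j => exact congrArg some (D.cluster_eq_of_map_some_eq hx' hy' h)
  vertex := by
    intro i j h
    cases i with
    | none => cases j with
      | none => rfl
      | some j => cases h
    | some i => cases j with
      | none => cases h
      | some j =>
        change D.vertex _ + D.ρ _ • LinearIsometryEquiv.piLpCongrLeft 2 ℝ ℝ _ 0 =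
          D.vertex _ + D.ρ _ • LinearIsometryEquiv.piLpCongrLeft 2 ℝ ℝ _ 0
        rw [Option.some_injective _ h]
        simp
  eq_zero := by
    intro i j hij x hx y hy h
    have hx' := D.attractor_subset hx
    have hy' := D.attractor_subset hy
    cases i with
    | none =>
      cases j with
      | none => exact absurd rfl hij
      | some j =>
        exact absurd h (D.map_none_ne_map_some (D.cone_subset_cube hx') (D.cone_subset_cube hy') j)
    | some i =>
      cases j with
      | none =>
        exact absurd h.symm
          (D.map_none_ne_map_some (D.cone_subset_cube hy') (D.cone_subset_cube hx') i)
      | some j => exact D.eq_zero_of_map_some_eq (fun e => hij (congrArg some e)) hx' hy' h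

lemma exists_clusterData {α κ : Type} [Fintype α] [Fintype κ] (k : α → κ) (ρ : Option α → ℝ)
    (hρ0 : ∀ i, 0 < ρ i) (hρ1 : ∀ i, ρ i ≤ 1 / 20) :
    ∃ (d : ℕ) (D : ClusterData d α κ), D.k = k ∧ D.ρ = ρ := by
  let φ : Option (α ⊕ κ) ≃ Fin (Fintype.card (Option (α ⊕ κ))) := Fintype.equivFin _
  refine ⟨_, ⟨φ none, fun i => φ (some (Sum.inl i)), fun c => φ (some (Sum.inr c)), ?_, ?_, ?_, ?_,
    ?_, k, ρ, hρ0, hρ1⟩, rfl, rfl⟩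
  · exact fun i j h => by simpa using h
  · exact fun i j h => by simpa using h
  · exact fun i h => by simp at h
  · exact fun i h => by simp at h
  · exact fun i c h => by simp at h

lemma idealOf_toIFS {p : ℝ} {e : Option α → ℕ} [DecidableEq κ] (hpos : 0 < D.toIFS.hdim)
    (hsum : ∑ i, D.ρ i ^ D.toIFS.hdim = 1) (he : ∀ i, D.ρ i ^ D.toIFS.hdim = p ^ e i)
    (hk : ∃ i j, i ≠ j ∧ D.k i = D.k j) :
    D.toIFS.idealOf p =
      Ideal.span (range fun c => ∑ i with D.k i = c, Zring.gen p ^ e (some i)) := by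
  refine D.clustered.idealOf_eq hpos (D.isAttractor.hausdorffMeasure_ne_top hpos.le hsum)
    (D.isAttractor.hausdorffMeasure_ne_zero D.oscSet hpos.le hsum) he D.oscSet ?_ ?_ ?_
  · rintro (_ | i) hi
    · exact absurd rfl hi
    · rintro _ ⟨x, hx, rfl⟩
      exact D.map_some_mem_openCone (D.cone_subset_cube (D.attractor_subset hx)) i
  · obtain ⟨i, j, hij, h⟩ := hk
    exact ⟨some i, some j, fun e => hij (Option.some_injective _ e), congrArg some h⟩
  · have hsum_some : ∀ c, (∑ i : Option α with Option.map D.k i = some c, Zring.gen p ^ e i) =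
        ∑ i with D.k i = c, Zring.gen p ^ e (some i) := fun c => by
      rw [Finset.sum_filter, Finset.sum_filter, Fintype.sum_option]
      simp
    congr 1
    ext x
    constructor
    · rintro ⟨c, rfl⟩
      exact ⟨some c, Option.some_ne_none c, (hsum_some c).symm⟩
    · rintro ⟨c, hc, rfl⟩
      cases c with
      | none => exact absurd rfl hc
      | some c => exact ⟨c, (hsum_some c).symm⟩

end ClusterData

/-- **Theorem.** Suppose `TOEC(p,r) ≠ ∅`. Then for every nonzero ideal `I` of `ℤ[p]`
there exists an IFS `S ∈ TOEC(p,r)` with `I_S = I`. -/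
theorem exists_ifs_with_ideal (p r : ℝ)
    (hp0 : 0 < p) (hp1 : p < 1) (hr0 : 0 < r) (hr1 : r < 1)
    (hne : ∃ (d : ℕ) (S : IFS d), S.MemTOECpr p r)
    (I : Ideal (Zring p)) (hI : I ≠ ⊥) :
    ∃ (d : ℕ) (S : IFS d), S.MemTOECpr p r ∧ S.idealOf p = I := by
  obtain ⟨d₀, T, hT⟩ := hne
  obtain ⟨hs, lam, hlam, hsum, hgcd⟩ := hT.exists_exponents hp1
  have hp : p = r ^ T.hdim := hT.2.2
  set s := T.hdim
  obtain ⟨m, hm⟩ := exists_pow_lt_of_lt_one (show (0 : ℝ) < 1 / 20 by norm_num) hr1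
  obtain ⟨n, α, κ, _, _, _, e, k, hn, he, hsum', ⟨i, j, hij, hkij, hei, hej⟩, hspan⟩ :=
    Zring.exists_clusters hp0 hp1 hlam hsum hgcd hI (m + 1)
  set E : Option α → ℕ := fun i => i.elim n e
  have hE : ∀ i, m + 1 ≤ E i := by
    rintro (_ | i)
    · exact hn
    · exact he i
  obtain ⟨d, D, hDk, hDρ⟩ := ClusterData.exists_clusterData k (fun i => r ^ E i)
    (fun i => pow_pos hr0 _) fun i =>
      (pow_le_pow_of_le_one hr0.le hr1.le ((Nat.le_succ m).trans (hE i))).trans hm.le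
  have hpow : ∀ i, D.ρ i ^ s = p ^ E i := fun i => by
    have hi : D.ρ i = r ^ E i := congrFun hDρ i
    rw [hi, hp, ← Real.rpow_natCast, ← Real.rpow_natCast, ← Real.rpow_mul hr0.le,
      ← Real.rpow_mul hr0.le, mul_comm]
  have hsumρ : ∑ i, D.ρ i ^ s = 1 := by
    simp only [hpow]
    rw [Fintype.sum_option]
    exact hsum'
  have hdim : D.toIFS.hdim = s := D.isAttractor.dimH_eq D.oscSet hs.le hsumρ
  have hroot : D.toIFS.IsRatioRoot r := by
    refine ⟨hr0, hr1, E, fun i => (Nat.succ_pos m).trans_le (hE i), fun i => congrFun hDρ i, ?_⟩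
    have h1 : Finset.univ.gcd E ∣ n := hei ▸ Finset.gcd_dvd (Finset.mem_univ (some i))
    have h2 : Finset.univ.gcd E ∣ n + 1 := hej ▸ Finset.gcd_dvd (Finset.mem_univ (some j))
    exact Nat.dvd_one.1 ((Nat.dvd_add_right h1).1 h2)
  refine ⟨d, D.toIFS, ⟨⟨⟨_, D.oscSet⟩, ⟨r, hroot⟩, D.clustered.isTotallyDisconnected⟩, hroot, ?_⟩,
    ?_⟩
  · rw [hdim, hp]
  · rw [← hspan, D.idealOf_toIFS (e := E) (hdim ▸ hs) (hdim ▸ hsumρ) (hdim ▸ hpow)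
      ⟨i, j, hij, by rw [hDk]; exact hkij⟩, hDk]
    rfl

end
end
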